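/- arXiv:math/0612588 — 4 statements merged into one kernel-verified Lean document; each statement's English description precedes it below -/
import Mathlib

section
/- Let b₀, b₁, …, b_n be distinct nonzero real numbers and let 0 < c ≤ 1. Then there is a constant C, depending only on c and b₀, …, b_n, such that for all real parameters μ₁, …, μ_n, all a, b with c ≤ a < b ≤ c^{-1}, and all λ > 0, the phase φ(t) = t^{b₀} + μ₁ t^{b₁} + ⋯ + μ_n t^{b_n} satisfies |∫_a^b e^{iλφ(t)} dt| ≤ C · λ^{−1/(n+1)}. -/
open MeasureTheory Real Filter
open scoped Topology ENNReal

/-- The generalized polynomial `∑ i, k i * t ^ e i` with real exponents. -/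
noncomputable def genPoly {m : ℕ} (k e : Fin m → ℝ) (t : ℝ) : ℝ :=
  ∑ i, k i * t ^ e i

lemma genPoly_hasDerivAt {m : ℕ} (k e : Fin m → ℝ) {t : ℝ} (ht : 0 < t) :
    HasDerivAt (genPoly k e) (genPoly (fun i => k i * e i) (fun i => e i - 1) t) t := by
  unfold genPoly
  have h : ∀ i ∈ (Finset.univ : Finset (Fin m)),
      HasDerivAt (fun x : ℝ => k i * x ^ e i) (k i * e i * t ^ (e i - 1)) t := fun i _ => by
    simpa [mul_assoc] using (Real.hasDerivAt_rpow_const (p := e i) (Or.inl ht.ne')).const_mul (k i)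
  exact HasDerivAt.fun_sum h

lemma genPoly_continuousOn {m : ℕ} (k e : Fin m → ℝ) : ContinuousOn (genPoly k e) (Set.Ioi 0) :=
  fun _ ht => (genPoly_hasDerivAt k e ht).continuousAt.continuousWithinAt

/-- Factoring out one power of `t`. -/
lemma genPoly_shift {m : ℕ} (k e : Fin m → ℝ) (r : ℝ) {t : ℝ} (ht : 0 < t) :
    genPoly k (fun i => e i - r) t = t ^ (-r) * genPoly k e t := by
  simp only [genPoly, Finset.mul_sum]
  refine Finset.sum_congr rfl fun i _ => ?_
  rw [sub_eq_add_neg, Real.rpow_add ht]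
  ring

/-- After factoring out the last power, differentiation removes one term. -/
lemma genPoly_shift_last_hasDerivAt {m : ℕ} (k e : Fin (m + 1) → ℝ) {t : ℝ} (ht : 0 < t) :
    HasDerivAt (genPoly k (fun i => e i - e (Fin.last m)))
      (genPoly (fun i : Fin m => k i.castSucc * (e i.castSucc - e (Fin.last m)))
        (fun i => e i.castSucc - e (Fin.last m) - 1) t) t := by
  have h := genPoly_hasDerivAt k (fun i => e i - e (Fin.last m)) ht
  convert h using 1
  simp [genPoly, Fin.sum_univ_castSucc]

/-- If a generalized polynomial is at most `δ` at `2 ^ n` points with gaps at least `s`,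
then its first coefficient is `O(δ / s ^ n)`. -/
lemma genPoly_coeff_bound {p : ℝ} (q : ℝ) (hp : 0 < p) (n : ℕ) (e : Fin (n + 1) → ℝ)
    (he : Function.Injective e) :
    ∃ K : ℝ, 0 < K ∧ ∀ (k : Fin (n + 1) → ℝ) (s δ : ℝ) (t : ℕ → ℝ), 0 < s →
      (∀ j < 2 ^ n, t j ∈ Set.Icc p q) → (∀ j, j + 1 < 2 ^ n → t j + s ≤ t (j + 1)) →
      (∀ j < 2 ^ n, |genPoly k e (t j)| ≤ δ) → |k 0| * s ^ n ≤ K * δ := by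
  have hbound : ∀ r : ℝ, ∃ M : ℝ, 0 < M ∧ ∀ x ∈ Set.Icc p q, x ^ r ≤ M := fun r => by
    obtain ⟨M, hM⟩ := isCompact_Icc.exists_bound_of_continuousOn
      (f := fun x : ℝ => x ^ r) (s := Set.Icc p q)
      (fun x hx => (Real.continuousAt_rpow_const x r
        (Or.inl (hp.trans_le hx.1).ne')).continuousWithinAt)
    exact ⟨max M 1, by positivity,
      fun x hx => (le_abs_self _).trans ((hM x hx).trans (le_max_left _ _))⟩
  induction n with
  | zero =>
    obtain ⟨M, hM0, hM⟩ := hbound (-e 0)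
    refine ⟨M, hM0, fun k s δ t _ ht _ hδ => ?_⟩
    have h0 := ht 0 (by simp)
    have hpos : 0 < t 0 := hp.trans_le h0.1
    have h1 := hδ 0 (by simp)
    have h2 : k 0 = t 0 ^ (-e 0) * genPoly k e (t 0) := by
      rw [← genPoly_shift k e _ hpos]
      simp [genPoly]
    rw [pow_zero, mul_one, h2, abs_mul, abs_of_nonneg (Real.rpow_nonneg hpos.le _)]
    exact mul_le_mul (hM _ h0) h1 (abs_nonneg _) hM0.le
  | succ n ih =>
    obtain ⟨K, hK0, hK⟩ := ih (fun i => e i.castSucc - e (Fin.last (n + 1)) - 1)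
      (fun i j hij => by simpa using he (show e i.castSucc = e j.castSucc by
        simpa using hij))
    obtain ⟨M, hM0, hM⟩ := hbound (-e (Fin.last (n + 1)))
    have hd : 0 < |e 0 - e (Fin.last (n + 1))| :=
      abs_pos.2 (sub_ne_zero.2 fun h => by simpa [Fin.ext_iff] using he h)
    refine ⟨2 * K * M / |e 0 - e (Fin.last (n + 1))|, by positivity,
      fun k s δ t hs ht hgap hδ => ?_⟩
    set g := genPoly k (fun i => e i - e (Fin.last (n + 1))) with hg
    set g' := genPoly (fun i : Fin (n + 1) => k i.castSucc * (e i.castSucc - e (Fin.last (n + 1))))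
        (fun i => e i.castSucc - e (Fin.last (n + 1)) - 1) with hg'
    have hgb : ∀ j < 2 ^ (n + 1), |g (t j)| ≤ M * δ := fun j hj => by
      have hpos : 0 < t j := hp.trans_le (ht j hj).1
      rw [hg, genPoly_shift k e _ hpos, abs_mul, abs_of_nonneg (Real.rpow_nonneg hpos.le _)]
      exact mul_le_mul (hM _ (ht j hj)) (hδ j hj) (abs_nonneg _) hM0.le
    have hex : ∀ j, ∃ ξ, j < 2 ^ n →
        ξ ∈ Set.Ioo (t (2 * j)) (t (2 * j + 1)) ∧ |g' ξ| ≤ 2 * M * δ / s := fun j => by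
      by_cases hj : j < 2 ^ n
      swap
      · exact ⟨0, fun h => absurd h hj⟩
      have hj1 : 2 * j + 1 < 2 ^ (n + 1) := by rw [pow_succ]; omega
      have hj0 : 2 * j < 2 ^ (n + 1) := by omega
      have hst := hgap (2 * j) hj1
      have hp0 : 0 < t (2 * j) := hp.trans_le (ht _ hj0).1
      obtain ⟨ξ, hξ, heq⟩ := exists_hasDerivAt_eq_slope g g'
        (show t (2 * j) < t (2 * j + 1) by linarith)
        ((genPoly_continuousOn _ _).mono fun x hx => hp0.trans_le hx.1)
        (fun x hx => genPoly_shift_last_hasDerivAt k e (hp0.trans hx.1))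
      refine ⟨ξ, fun _ => ⟨hξ, ?_⟩⟩
      have h1 := abs_le.1 (hgb _ hj0)
      have h2 := abs_le.1 (hgb _ hj1)
      rw [heq, abs_div, abs_of_pos (show 0 < t (2 * j + 1) - t (2 * j) by linarith)]
      have h3 : |g (t (2 * j + 1)) - g (t (2 * j))| ≤ 2 * M * δ :=
        abs_le.2 ⟨by linarith, by linarith⟩
      exact div_le_div₀ ((abs_nonneg _).trans h3) h3 hs (by linarith)
    choose ξ hξ using hex
    have key := hK (fun i => k i.castSucc * (e i.castSucc - e (Fin.last (n + 1)))) s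
      (2 * M * δ / s) ξ hs
      (fun j hj => by
        have h := (hξ j hj).1
        have hj1 : 2 * j + 1 < 2 ^ (n + 1) := by rw [pow_succ]; omega
        exact ⟨(ht (2 * j) (by omega)).1.trans h.1.le, h.2.le.trans (ht _ hj1).2⟩)
      (fun j hj => by
        have h := (hξ j (by omega)).1.2
        have h' := (hξ (j + 1) hj).1.1
        have := hgap (2 * j + 1) (by rw [pow_succ]; omega)
        rw [show 2 * (j + 1) = 2 * j + 1 + 1 by ring] at h'
        linarith)
      (fun j hj => (hξ j hj).2)
    simp only [Fin.castSucc_zero, abs_mul] at key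
    rw [div_mul_eq_mul_div, le_div_iff₀ hd]
    calc |k 0| * s ^ (n + 1) * |e 0 - e (Fin.last (n + 1))|
        = |k 0| * |e 0 - e (Fin.last (n + 1))| * s ^ n * s := by ring
      _ ≤ K * (2 * M * δ / s) * s := mul_le_mul_of_nonneg_right key hs.le
      _ = 2 * K * M * δ := by field_simp

/-- Sublevel set estimate for generalized polynomials on an interval. -/
lemma genPoly_sublevel_bound {p : ℝ} (q : ℝ) (hp : 0 < p) (n : ℕ) (e : Fin (n + 1) → ℝ)
    (he : Function.Injective e) :
    ∃ K : ℝ, 0 < K ∧ ∀ (k : Fin (n + 1) → ℝ) (δ x y : ℝ), p ≤ x → x < y → y ≤ q →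
      (∀ t ∈ Set.Icc x y, |genPoly k e t| ≤ δ) → |k 0| * (y - x) ^ n ≤ K * δ := by
  obtain ⟨K, hK0, hK⟩ := genPoly_coeff_bound q hp n e he
  refine ⟨K * (2 ^ n) ^ n, by positivity, fun k δ x y hx hxy hy hδ => ?_⟩
  have hN : (0 : ℝ) < 2 ^ n := by positivity
  have hs : 0 < (y - x) / 2 ^ n := div_pos (sub_pos.2 hxy) hN
  have hmem : ∀ j : ℕ, j < 2 ^ n → x + j * ((y - x) / 2 ^ n) ∈ Set.Icc x y := fun j hj => by
    have hj' : (j : ℝ) ≤ 2 ^ n := by exact_mod_cast hj.le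
    have h1 : (j : ℝ) * ((y - x) / 2 ^ n) ≤ 2 ^ n * ((y - x) / 2 ^ n) :=
      mul_le_mul_of_nonneg_right hj' hs.le
    rw [mul_div_cancel₀ _ hN.ne'] at h1
    have h2 : 0 ≤ (j : ℝ) * ((y - x) / 2 ^ n) := by positivity
    exact ⟨by linarith, by linarith⟩
  have key := hK k ((y - x) / 2 ^ n) δ (fun j => x + j * ((y - x) / 2 ^ n)) hs
    (fun j hj => ⟨hx.trans (hmem j hj).1, (hmem j hj).2.trans hy⟩)
    (fun j _ => by push_cast; linarith)
    (fun j hj => hδ _ (hmem j hj))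
  rw [div_pow, ← mul_div_assoc, div_le_iff₀ (by positivity)] at key
  linarith

/-- A monotone or antitone continuous function crosses a level at most once: a subadditive
interval function bounded where `g` stays on one side of `d` is at most twice that bound. -/
lemma subadditive_le_of_level {g : ℝ → ℝ} {Φ : ℝ → ℝ → ℝ} {x y d B : ℝ} (hxy : x ≤ y)
    (hc : ContinuousOn g (Set.Icc x y))
    (hm : MonotoneOn g (Set.Icc x y) ∨ AntitoneOn g (Set.Icc x y))
    (hΦ : ∀ u v w, x ≤ u → u ≤ v → v ≤ w → w ≤ y → Φ u w ≤ Φ u v + Φ v w)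
    (hB : ∀ u v, x ≤ u → u ≤ v → v ≤ y →
      ((∀ t ∈ Set.Icc u v, d ≤ g t) ∨ (∀ t ∈ Set.Icc u v, g t ≤ d)) → Φ u v ≤ B) :
    Φ x y ≤ 2 * B := by
  have hx : x ∈ Set.Icc x y := ⟨le_rfl, hxy⟩
  have hy : y ∈ Set.Icc x y := ⟨hxy, le_rfl⟩
  suffices h : ∃ z ∈ Set.Icc x y,
      ((∀ t ∈ Set.Icc x z, d ≤ g t) ∨ (∀ t ∈ Set.Icc x z, g t ≤ d)) ∧
      ((∀ t ∈ Set.Icc z y, d ≤ g t) ∨ (∀ t ∈ Set.Icc z y, g t ≤ d)) by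
    obtain ⟨z, hz, h1, h2⟩ := h
    have := hΦ x z y le_rfl hz.1 hz.2 le_rfl
    have := hB x z le_rfl hz.1 hz.2 h1
    have := hB z y hz.1 hz.2 le_rfl h2
    linarith
  have hcross : (∃ z ∈ Set.Icc x y, g z = d) ∨ (∀ t ∈ Set.Icc x y, d ≤ g t) ∨
      (∀ t ∈ Set.Icc x y, g t ≤ d) := by
    by_contra! hcon
    obtain ⟨h1, ⟨u, hu, hud⟩, ⟨v, hv, hvd⟩⟩ := hcon
    obtain ⟨z, hz, hzd⟩ := isPreconnected_Icc.intermediate_value hu hv hc ⟨hud.le, hvd.le⟩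
    exact h1 z hz hzd
  rcases hcross with ⟨z, hz, hzd⟩ | h | h
  · refine ⟨z, hz, ?_⟩
    rcases hm with hm | hm
    · exact ⟨Or.inr fun t ht => hzd ▸ hm ⟨ht.1, ht.2.trans hz.2⟩ hz ht.2,
        Or.inl fun t ht => hzd ▸ hm hz ⟨hz.1.trans ht.1, ht.2⟩ ht.1⟩
    · exact ⟨Or.inl fun t ht => hzd ▸ hm ⟨ht.1, ht.2.trans hz.2⟩ hz ht.2,
        Or.inr fun t ht => hzd ▸ hm hz ⟨hz.1.trans ht.1, ht.2⟩ ht.1⟩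
  · exact ⟨y, hy, Or.inl h, Or.inl fun t ht => h t ⟨hxy.trans ht.1, ht.2⟩⟩
  · exact ⟨y, hy, Or.inr h, Or.inr fun t ht => h t ⟨hxy.trans ht.1, ht.2⟩⟩

lemma monotoneOn_or_antitoneOn_of_hasDerivAt {g g' : ℝ → ℝ} {x y : ℝ}
    (hd : ∀ t ∈ Set.Icc x y, HasDerivAt g (g' t) t)
    (hs : (∀ t ∈ Set.Icc x y, 0 ≤ g' t) ∨ (∀ t ∈ Set.Icc x y, g' t ≤ 0)) :
    MonotoneOn g (Set.Icc x y) ∨ AntitoneOn g (Set.Icc x y) := by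
  have hc : ContinuousOn g (Set.Icc x y) := fun t ht => (hd t ht).continuousAt.continuousWithinAt
  have hw : ∀ t ∈ interior (Set.Icc x y),
      HasDerivWithinAt g (g' t) (interior (Set.Icc x y)) t :=
    fun t ht => (hd t (interior_subset ht)).hasDerivWithinAt
  exact hs.imp
    (fun h => monotoneOn_of_hasDerivWithinAt_nonneg (convex_Icc x y) hc hw
      fun t ht => h t (interior_subset ht))
    (fun h => antitoneOn_of_hasDerivWithinAt_nonpos (convex_Icc x y) hc hw
      fun t ht => h t (interior_subset ht))

/-- A generalized polynomial with `m` terms has at most `2 ^ m` intervals of constant sign,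
phrased through subadditive interval functions. -/
lemma genPoly_subadditive_le {m : ℕ} (k e : Fin m → ℝ) {Φ : ℝ → ℝ → ℝ} {a b B : ℝ}
    (ha : 0 < a) (hab : a ≤ b)
    (hΦ : ∀ u v w, a ≤ u → u ≤ v → v ≤ w → w ≤ b → Φ u w ≤ Φ u v + Φ v w)
    (hB : ∀ u v, a ≤ u → u ≤ v → v ≤ b →
      ((∀ t ∈ Set.Icc u v, 0 ≤ genPoly k e t) ∨ (∀ t ∈ Set.Icc u v, genPoly k e t ≤ 0)) →
      Φ u v ≤ B) :
    Φ a b ≤ 2 ^ m * B := by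
  induction m generalizing B with
  | zero => simpa using hB a b le_rfl hab le_rfl (Or.inl fun t _ => by simp [genPoly])
  | succ m ih =>
    rw [pow_succ, mul_assoc]
    refine ih (fun i => k i.castSucc * (e i.castSucc - e (Fin.last m)))
      (fun i => e i.castSucc - e (Fin.last m) - 1) fun x y hx hxy hy hsign => ?_
    have hpos : ∀ t ∈ Set.Icc x y, 0 < t := fun t ht => ha.trans_le (hx.trans ht.1)
    refine subadditive_le_of_level (g := genPoly k (fun i => e i - e (Fin.last m))) (d := 0) hxy
      ((genPoly_continuousOn _ _).mono hpos)
      (monotoneOn_or_antitoneOn_of_hasDerivAt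
        (fun t ht => genPoly_shift_last_hasDerivAt k e (hpos t ht)) hsign)
      (fun u v w hu huv hvw hw => hΦ u v w (hx.trans hu) huv hvw (hw.trans hy))
      (fun u v hu huv hv h => hB u v (hx.trans hu) huv (hv.trans hy) ?_)
    have hpos' : ∀ t ∈ Set.Icc u v, 0 < t := fun t ht => hpos t ⟨hu.trans ht.1, ht.2.trans hv⟩
    refine h.imp (fun h t ht => ?_) (fun h t ht => ?_)
    · have h1 := h t ht
      rw [genPoly_shift k e _ (hpos' t ht)] at h1
      exact nonneg_of_mul_nonneg_right h1 (Real.rpow_pos_of_pos (hpos' t ht) _)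
    · have h1 := h t ht
      rw [genPoly_shift k e _ (hpos' t ht)] at h1
      exact nonpos_of_mul_nonpos_right h1 (Real.rpow_pos_of_pos (hpos' t ht) _)

/-- The first-derivative van der Corput estimate. -/
lemma norm_integral_exp_le_of_deriv_ge {φ f f' : ℝ → ℝ} {x y lam δ : ℝ} (hxy : x ≤ y)
    (hlam : 0 < lam) (hδ : 0 < δ)
    (hφ : ∀ t ∈ Set.Icc x y, HasDerivAt φ (f t) t)
    (hf : ∀ t ∈ Set.Icc x y, HasDerivAt f (f' t) t)
    (hf' : ContinuousOn f' (Set.Icc x y))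
    (hs : (∀ t ∈ Set.Icc x y, 0 ≤ f' t) ∨ (∀ t ∈ Set.Icc x y, f' t ≤ 0))
    (hfδ : (∀ t ∈ Set.Icc x y, δ ≤ f t) ∨ (∀ t ∈ Set.Icc x y, f t ≤ -δ)) :
    ‖∫ t in x..y, Complex.exp (Complex.I * lam * (φ t : ℂ))‖ ≤ 4 / (lam * δ) := by
  have hu : Set.uIcc x y = Set.Icc x y := Set.uIcc_of_le hxy
  have hfa : ∀ t ∈ Set.Icc x y, δ ≤ |f t| := fun t ht => by
    rcases hfδ with h | h
    · exact (h t ht).trans (le_abs_self _)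
    · exact (le_neg.2 (h t ht)).trans (neg_le_abs _)
  have hf0 : ∀ t ∈ Set.Icc x y, f t ≠ 0 := fun t ht => abs_pos.1 (hδ.trans_le (hfa t ht))
  have hfc : ContinuousOn f (Set.Icc x y) := fun t ht => (hf t ht).continuousAt.continuousWithinAt
  have hφc : ContinuousOn φ (Set.Icc x y) := fun t ht => (hφ t ht).continuousAt.continuousWithinAt
  have hinv : ∀ t ∈ Set.Icc x y, |(f t)⁻¹| ≤ δ⁻¹ := fun t ht => by
    rw [abs_inv]
    exact inv_anti₀ hδ (hfa t ht)
  have hL : (Complex.I * lam : ℂ) ≠ 0 :=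
    mul_ne_zero Complex.I_ne_zero (by exact_mod_cast hlam.ne')
  set E : ℝ → ℂ := fun t => Complex.exp (Complex.I * lam * (φ t : ℂ)) with hE
  have hEn : ∀ t, ‖E t‖ = 1 := fun t => by
    have : Complex.I * lam * (φ t : ℂ) = ((lam * φ t : ℝ) : ℂ) * Complex.I := by
      push_cast; ring
    rw [hE]
    simp only
    rw [this, Complex.norm_exp_ofReal_mul_I]
  have hEd : ∀ t ∈ Set.Icc x y, HasDerivAt E (E t * (Complex.I * lam * (f t : ℂ))) t :=
    fun t ht => (((hφ t ht).ofReal_comp).const_mul (Complex.I * lam : ℂ)).cexp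
  have hEc : ContinuousOn E (Set.Icc x y) :=
    fun t ht => (hEd t ht).continuousAt.continuousWithinAt
  have hid : ∀ t ∈ Set.Icc x y,
      HasDerivAt (fun t => (f t)⁻¹) (-f' t / f t ^ 2) t := fun t ht => (hf t ht).inv (hf0 t ht)
  have hidc : ContinuousOn (fun t => -f' t / f t ^ 2) (Set.Icc x y) :=
    hf'.neg.div (hfc.pow 2) fun t ht => pow_ne_zero 2 (hf0 t ht)
  have hparts := intervalIntegral.integral_mul_deriv_eq_deriv_mul
    (a := x) (b := y) (u := fun t => (((f t)⁻¹ : ℝ) : ℂ)) (v := E)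
    (u' := fun t => ((-f' t / f t ^ 2 : ℝ) : ℂ)) (v' := fun t => E t * (Complex.I * lam * (f t : ℂ)))
    (fun t ht => (hid t (hu ▸ ht)).ofReal_comp) (fun t ht => hEd t (hu ▸ ht))
    (ContinuousOn.intervalIntegrable (hu ▸ Complex.continuous_ofReal.comp_continuousOn hidc))
    (ContinuousOn.intervalIntegrable (hu ▸ hEc.mul
      (continuousOn_const.mul (Complex.continuous_ofReal.comp_continuousOn hfc))))
  have hleft : ∫ t in x..y, (((f t)⁻¹ : ℝ) : ℂ) * (E t * (Complex.I * lam * (f t : ℂ))) =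
      Complex.I * lam * ∫ t in x..y, E t := by
    rw [← intervalIntegral.integral_const_mul]
    refine intervalIntegral.integral_congr fun t ht => ?_
    have : (f t : ℂ) ≠ 0 := by exact_mod_cast hf0 t (hu ▸ ht)
    push_cast
    field_simp
  have hxm : x ∈ Set.Icc x y := ⟨le_rfl, hxy⟩
  have hym : y ∈ Set.Icc x y := ⟨hxy, le_rfl⟩
  have hFTC : ∫ t in x..y, -f' t / f t ^ 2 = (f y)⁻¹ - (f x)⁻¹ :=
    intervalIntegral.integral_eq_sub_of_hasDerivAt (fun t ht => hid t (hu ▸ ht))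
      (ContinuousOn.intervalIntegrable (hu ▸ hidc))
  have hdiff : |(f y)⁻¹ - (f x)⁻¹| ≤ 2 * δ⁻¹ := by
    have h1 := abs_sub (f y)⁻¹ (f x)⁻¹
    linarith [hinv x hxm, hinv y hym]
  have habs : ∫ t in x..y, |-f' t / f t ^ 2| ≤ 2 * δ⁻¹ := by
    rcases hs with h | h
    · have : ∫ t in x..y, |-f' t / f t ^ 2| = -∫ t in x..y, -f' t / f t ^ 2 := by
        rw [← intervalIntegral.integral_neg]
        refine intervalIntegral.integral_congr fun t ht => abs_of_nonpos ?_
        exact div_nonpos_of_nonpos_of_nonneg (neg_nonpos.2 (h t (hu ▸ ht))) (sq_nonneg _)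
      rw [this, hFTC]
      exact (neg_le_abs _).trans hdiff
    · have : ∫ t in x..y, |-f' t / f t ^ 2| = ∫ t in x..y, -f' t / f t ^ 2 := by
        refine intervalIntegral.integral_congr fun t ht => abs_of_nonneg ?_
        exact div_nonneg (neg_nonneg.2 (h t (hu ▸ ht))) (sq_nonneg _)
      rw [this, hFTC]
      exact (le_abs_self _).trans hdiff
  have hrem : ‖∫ t in x..y, ((-f' t / f t ^ 2 : ℝ) : ℂ) * E t‖ ≤ 2 * δ⁻¹ := by
    refine (intervalIntegral.norm_integral_le_integral_norm hxy).trans (le_of_eq_of_le ?_ habs)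
    simp only [norm_mul, hEn, mul_one, Complex.norm_real, Real.norm_eq_abs]
  rw [hleft] at hparts
  have hbd : ∀ t ∈ Set.Icc x y, ‖(((f t)⁻¹ : ℝ) : ℂ) * E t‖ ≤ δ⁻¹ := fun t ht => by
    rw [norm_mul, hEn, mul_one, Complex.norm_real]
    exact hinv t ht
  have htot : lam * ‖∫ t in x..y, E t‖ ≤ 4 * δ⁻¹ := by
    have h1 : lam * ‖∫ t in x..y, E t‖ = ‖Complex.I * lam * ∫ t in x..y, E t‖ := by
      rw [norm_mul, norm_mul, Complex.norm_I, one_mul, Complex.norm_real, Real.norm_eq_abs,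
        abs_of_pos hlam]
    rw [h1, hparts]
    refine (norm_sub_le _ _).trans ?_
    have h2 := norm_sub_le ((((f y)⁻¹ : ℝ) : ℂ) * E y) ((((f x)⁻¹ : ℝ) : ℂ) * E x)
    linarith [hbd x hxm, hbd y hym]
  rw [le_div_iff₀ (by positivity)]
  calc ‖∫ t in x..y, E t‖ * (lam * δ) = lam * ‖∫ t in x..y, E t‖ * δ := by ring
    _ ≤ 4 * δ⁻¹ * δ := mul_le_mul_of_nonneg_right htot hδ.le
    _ = 4 := by field_simp

/-- Oscillatory integral estimate of Ricci–Stein type for phases with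
distinct nonzero real exponents, uniform over intervals `[a,b] ⊆ [c, c⁻¹]`. -/
theorem oscillatory_estimate_distinct_nonzero_exponents
    (n : ℕ) (b : Fin (n + 1) → ℝ)
    (hb_inj : Function.Injective b) (hb_ne : ∀ i, b i ≠ 0)
    (c : ℝ) (hc : 0 < c) (hc1 : c ≤ 1) :
    ∃ C : ℝ, 0 < C ∧
      ∀ (μ : Fin n → ℝ) (a b' : ℝ), c ≤ a → a < b' → b' ≤ c⁻¹ →
        ∀ lam : ℝ, 0 < lam →
          ‖∫ t in a..b', Complex.exp (Complex.I * lam *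
              ((t ^ (b 0) + ∑ i : Fin n, μ i * t ^ (b i.succ) : ℝ) : ℂ))‖
            ≤ C * lam ^ (-(1 / (n + 1 : ℝ))) := by
  obtain ⟨K, hK0, hK⟩ := genPoly_sublevel_bound c⁻¹ hc n (fun i => b i - 1)
    (fun i j h => hb_inj (by simpa using h))
  have hb0 : 0 < |b 0| := abs_pos.2 (hb_ne 0)
  set η : ℝ := |b 0| / (2 * K) with hη
  have hη0 : 0 < η := by positivity
  refine ⟨2 ^ (n + 1) * (2 * (2 * (4 / η + 1))), by positivity,
    fun μ a b' ha hab hb' lam hlam => ?_⟩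
  have ha0 : 0 < a := hc.trans_le ha
  set r : ℝ := lam ^ (-(1 / (n + 1 : ℝ))) with hr
  have hr0 : 0 < r := Real.rpow_pos_of_pos hlam _
  have hrn : r ^ (n + 1) = lam⁻¹ := by
    rw [hr, ← Real.rpow_natCast, ← Real.rpow_mul hlam.le, ← Real.rpow_neg_one]
    congr 1
    push_cast
    field_simp
  set δ : ℝ := η * r ^ n with hδ
  have hδ0 : 0 < δ := by positivity
  set k : Fin (n + 1) → ℝ := Fin.cons 1 μ with hk
  have hphase : ∀ t : ℝ, t ^ (b 0) + ∑ i : Fin n, μ i * t ^ (b i.succ) = genPoly k b t :=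
    fun t => by simp [genPoly, hk, Fin.sum_univ_succ]
  simp only [hphase]
  set f := genPoly (fun i => k i * b i) (fun i => b i - 1) with hf
  set E : ℝ → ℂ := fun t => Complex.exp (Complex.I * lam * (genPoly k b t : ℂ)) with hE
  have hEn : ∀ t, ‖E t‖ ≤ 1 := fun t => by
    have : Complex.I * lam * (genPoly k b t : ℂ)
        = ((lam * genPoly k b t : ℝ) : ℂ) * Complex.I := by
      push_cast; ring
    rw [hE]
    simp only
    rw [this, Complex.norm_exp_ofReal_mul_I]
  have hEc : ContinuousOn E (Set.Ioi 0) := (continuousOn_const.mul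
    (Complex.continuous_ofReal.comp_continuousOn (genPoly_continuousOn k b))).cexp
  have hEi : ∀ u v, a ≤ u → u ≤ v → IntervalIntegrable E volume u v := fun u v hu huv =>
    (hEc.mono fun t ht => ha0.trans_le (hu.trans (Set.uIcc_of_le huv ▸ ht).1)).intervalIntegrable
  have hadd : ∀ u v w, a ≤ u → u ≤ v → v ≤ w →
      ‖∫ t in u..w, E t‖ ≤ ‖∫ t in u..v, E t‖ + ‖∫ t in v..w, E t‖ :=
    fun u v w hu huv hvw => by
      rw [← intervalIntegral.integral_add_adjacent_intervals (hEi u v hu huv)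
        (hEi v w (hu.trans huv) hvw)]
      exact norm_add_le _ _
  rw [mul_assoc]
  refine genPoly_subadditive_le (fun i => k i * b i * (b i - 1)) (fun i => b i - 1 - 1)
    (Φ := fun u v => ‖∫ t in u..v, E t‖) ha0 hab.le
    (fun u v w hu huv hvw _ => hadd u v w hu huv hvw) fun x y hx hxy hy hsign => ?_
  have hpos : ∀ t ∈ Set.Icc x y, 0 < t := fun t ht => ha0.trans_le (hx.trans ht.1)
  have hfc : ContinuousOn f (Set.Icc x y) := (genPoly_continuousOn _ _).mono hpos
  have hmono := monotoneOn_or_antitoneOn_of_hasDerivAt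
    (fun t ht => genPoly_hasDerivAt (fun i => k i * b i) (fun i => b i - 1) (hpos t ht)) hsign
  have hlarge : ∀ u v, x ≤ u → u ≤ v → v ≤ y →
      ((∀ t ∈ Set.Icc u v, δ ≤ f t) ∨ (∀ t ∈ Set.Icc u v, f t ≤ -δ)) →
      ‖∫ t in u..v, E t‖ ≤ (4 / η + 1) * r := fun u v hu huv hv h => by
    have hsub : Set.Icc u v ⊆ Set.Icc x y := Set.Icc_subset_Icc hu hv
    refine (norm_integral_exp_le_of_deriv_ge huv hlam hδ0
      (fun t ht => genPoly_hasDerivAt k b (hpos t (hsub ht)))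
      (fun t ht => genPoly_hasDerivAt _ _ (hpos t (hsub ht)))
      ((genPoly_continuousOn _ _).mono fun t ht => hpos t (hsub ht))
      (hsign.imp (fun h t ht => h t (hsub ht)) (fun h t ht => h t (hsub ht))) h).trans ?_
    have h1 : 4 / (lam * δ) = 4 / η * r := by
      have : lam = (r ^ (n + 1))⁻¹ := by rw [hrn, inv_inv]
      rw [this, hδ, pow_succ]
      field_simp
    rw [h1]
    linarith
  have hsmall : ∀ u v, x ≤ u → u ≤ v → v ≤ y → (∀ t ∈ Set.Icc u v, |f t| ≤ δ) →
      ‖∫ t in u..v, E t‖ ≤ (4 / η + 1) * r := fun u v hu huv hv h => by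
    have hlen : v - u ≤ r := by
      rcases huv.eq_or_lt with rfl | huv
      · simpa using hr0.le
      have h1 := hK _ δ u v (ha.trans (hx.trans hu)) huv (hv.trans (hy.trans hb')) h
      have h2 : K * δ = |b 0| * r ^ n / 2 := by
        rw [hδ, hη]
        field_simp
      have h3 : |k 0 * b 0| = |b 0| := by simp [hk]
      rw [h2, h3] at h1
      have h4 : (v - u) ^ n < r ^ n := by
        have h5 : |b 0| * (v - u) ^ n < |b 0| * r ^ n :=
          h1.trans_lt (half_lt_self (by positivity))
        exact lt_of_mul_lt_mul_left h5 hb0.le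
      exact (lt_of_pow_lt_pow_left₀ n hr0.le h4).le
    have h1 := intervalIntegral.norm_integral_le_of_norm_le_const (a := u) (b := v) (f := E)
      (C := 1) fun t _ => hEn t
    rw [one_mul, abs_of_nonneg (sub_nonneg.2 huv)] at h1
    have : 0 < 4 / η * r := by positivity
    linarith
  have hB0 : 0 ≤ (4 / η + 1) * r := by positivity
  rw [mul_assoc, mul_assoc]
  refine subadditive_le_of_level (g := f) (d := δ) (Φ := fun u v => ‖∫ t in u..v, E t‖) hxy hfc
    hmono (fun u v w hu huv hvw _ => hadd u v w (hx.trans hu) huv hvw) fun u v hu huv hv h => ?_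
  rcases h with h | h
  · have := hlarge u v hu huv hv (Or.inl h)
    linarith
  · have hsub : Set.Icc u v ⊆ Set.Icc x y := Set.Icc_subset_Icc hu hv
    refine subadditive_le_of_level (g := f) (d := -δ) (Φ := fun u v => ‖∫ t in u..v, E t‖) huv
      (hfc.mono hsub) (hmono.imp (fun h => h.mono hsub) (fun h => h.mono hsub))
      (fun u' v' w' hu' huv' hvw' _ => hadd u' v' w' (hx.trans (hu.trans hu')) huv' hvw')
      fun u' v' hu' huv' hv' h' => ?_
    rcases h' with h' | h'
    · exact hsmall u' v' (hu.trans hu') huv' (hv'.trans hv) fun t ht =>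
        abs_le.2 ⟨h' t ht, h t ⟨hu'.trans ht.1, ht.2.trans hv'⟩⟩
    · exact hlarge u' v' (hu.trans hu') huv' (hv'.trans hv) (Or.inr h')
end

section
/- Let b₀, b₁, …, b_n be distinct positive real numbers. Then there is a constant C, depending only on b₀, …, b_n, such that for all real parameters μ₁, …, μ_n, all 0 ≤ a < b ≤ 1, and all λ > 0, the phase φ(t) = t^{b₀} + μ₁ t^{b₁} + ⋯ + μ_n t^{b_n} satisfies |∫_a^b e^{iλφ(t)} dt| ≤ C · λ^{−min{1/b₀, 1/(n+1)}}. -/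
open MeasureTheory Real Filter
open scoped Topology ENNReal

/-- A generalized polynomial vanishes identically on the positive half-line or has at most as many
positive zeros as terms. -/
lemma sum_rpow_eq_zero_or_card_zeros_le {ι : Type*} (s : Finset ι) (c β : ι → ℝ) :
    (∀ t > 0, ∑ i ∈ s, c i * t ^ β i = 0) ∨
      ∃ S : Finset ℝ, S.card ≤ s.card ∧ ∀ t > 0, ∑ i ∈ s, c i * t ^ β i = 0 → t ∈ S := by
  classical
  induction s using Finset.induction_on generalizing c β with
  | empty => left; simp
  | insert k s hk ih =>
    set g : ℝ → ℝ := fun t ↦ c k + ∑ i ∈ s, c i * t ^ (β i - β k) with hg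
    have hfg : ∀ t > 0, ∑ i ∈ insert k s, c i * t ^ β i = t ^ β k * g t := by
      intro t ht
      rw [Finset.sum_insert hk, hg]
      simp only [mul_add, Finset.mul_sum]
      congr 1
      · ring
      · refine Finset.sum_congr rfl fun i _ ↦ ?_
        rw [mul_left_comm, ← rpow_add ht]
        ring_nf
    have hzero : ∀ t > 0, (∑ i ∈ insert k s, c i * t ^ β i = 0 ↔ g t = 0) := by
      intro t ht
      rw [hfg t ht, mul_eq_zero, or_iff_right (rpow_pos_of_pos ht _).ne']
    have hderiv : ∀ t > 0, HasDerivAt g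
        (∑ i ∈ s, c i * (β i - β k) * t ^ (β i - β k - 1)) t := by
      intro t ht
      refine HasDerivAt.const_add _ (HasDerivAt.fun_sum fun i _ ↦ ?_)
      rw [mul_assoc]
      exact (hasDerivAt_rpow_const (Or.inl ht.ne')).const_mul _
    rcases ih (fun i ↦ c i * (β i - β k)) (fun i ↦ β i - β k - 1) with h0 | ⟨S, hS, hSz⟩
    · have hconst : ∀ t > 0, g t = g 1 := fun t ht ↦
        (convex_Ioi (0 : ℝ)).is_const_of_fderivWithin_eq_zero (𝕜 := ℝ)
          (fun x hx ↦ (hderiv x hx).differentiableAt.differentiableWithinAt)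
          (fun x hx ↦ by
            have := (hderiv x hx).hasFDerivAt.hasFDerivWithinAt (s := Set.Ioi 0)
            rw [this.fderivWithin (isOpen_Ioi.uniqueDiffWithinAt hx), h0 x hx]
            ext; simp) ht (by simp)
      by_cases h1 : g 1 = 0
      · exact Or.inl fun t ht ↦ (hzero t ht).2 ((hconst t ht).trans h1)
      · exact Or.inr ⟨∅, by simp, fun t ht h ↦
          absurd ((hconst t ht).symm.trans ((hzero t ht).1 h)) h1⟩
    · right
      have hcard : ∀ T : Finset ℝ, (∀ t ∈ T, 0 < t ∧ g t = 0) → T.card ≤ s.card + 1 := by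
        intro T hT
        refine (Finset.card_le_of_interleaved (t := S) fun x hx y hy hxy _ ↦ ?_).trans
          (Nat.add_le_add_right hS 1)
        have hpos : ∀ z ∈ Set.Icc x y, 0 < z := fun z hz ↦ (hT x hx).1.trans_le hz.1
        obtain ⟨z, hz, hz0⟩ := exists_hasDerivAt_eq_zero hxy
          (fun z hz ↦ (hderiv z (hpos z hz)).continuousAt.continuousWithinAt)
          ((hT x hx).2.trans (hT y hy).2.symm)
          (fun z hz ↦ hderiv z (hpos z (Set.Ioo_subset_Icc_self hz)))
        exact ⟨z, hSz z (hpos z (Set.Ioo_subset_Icc_self hz)) hz0, hz⟩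
      have hfin : {t : ℝ | 0 < t ∧ g t = 0}.Finite := by
        by_contra hinf
        obtain ⟨T, hT, hTc⟩ := Set.Infinite.exists_subset_card_eq hinf (s.card + 2)
        have := hcard T fun t ht ↦ hT ht
        omega
      refine ⟨hfin.toFinset, ?_, fun t ht h ↦ ?_⟩
      · rw [Finset.card_insert_of_notMem hk]
        exact hcard _ fun t ht ↦ by simpa using ht
      · simpa using ⟨ht, (hzero t ht).1 h⟩

/-- The positive half-line splits into boundedly many intervals on each of which a generalized
polynomial has constant sign. -/
lemma exists_breakpoints_sum_rpow {ι : Type*} (s : Finset ι) (c β : ι → ℝ) :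
    ∃ S : Finset ℝ, S.card ≤ s.card ∧ ∀ u v : ℝ, 0 ≤ u → (∀ x ∈ S, x ∉ Set.Ioo u v) →
      (∀ t ∈ Set.Ioo u v, 0 ≤ ∑ i ∈ s, c i * t ^ β i) ∨
      (∀ t ∈ Set.Ioo u v, ∑ i ∈ s, c i * t ^ β i ≤ 0) := by
  rcases sum_rpow_eq_zero_or_card_zeros_le s c β with h | ⟨S, hS, hSz⟩
  · exact ⟨∅, by simp, fun u v hu _ ↦ Or.inl fun t ht ↦ (h t (hu.trans_lt ht.1)).ge⟩
  · refine ⟨S, hS, fun u v hu hdisj ↦ ?_⟩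
    by_contra! hcon
    obtain ⟨⟨x, hx, hx0⟩, y, hy, hy0⟩ := hcon
    have hcont : ContinuousOn (fun t : ℝ ↦ ∑ i ∈ s, c i * t ^ β i) (Set.Ioo u v) :=
      continuousOn_finsetSum _ fun i _ ↦ continuousOn_const.mul
        (continuousOn_id.rpow_const fun t ht ↦ Or.inl (hu.trans_lt ht.1).ne')
    obtain ⟨z, hz, hz0⟩ := isPreconnected_Ioo.intermediate_value hx hy hcont ⟨hx0.le, hy0.le⟩
    exact hdisj z (hSz z (hu.trans_lt hz.1) hz0) hz

/-- The positive half-line splits into boundedly many intervals on each of which the absolute value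
of a generalized polynomial stays on one side of a given threshold. -/
lemma exists_breakpoints_abs_sum_rpow {ι : Type*} [Fintype ι] (c β : ι → ℝ) (τ : ℝ) :
    ∃ S : Finset ℝ, S.card ≤ 2 * (Fintype.card ι + 1) ∧
      ∀ u v : ℝ, 0 ≤ u → (∀ x ∈ S, x ∉ Set.Ioo u v) →
      (∀ t ∈ Set.Ioo u v, τ ≤ |∑ i, c i * t ^ β i|) ∨
      (∀ t ∈ Set.Ioo u v, |∑ i, c i * t ^ β i| ≤ τ) := by
  classical
  have key : ∀ σ : ℝ, ∃ S : Finset ℝ, S.card ≤ Fintype.card ι + 1 ∧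
      ∀ u v : ℝ, 0 ≤ u → (∀ x ∈ S, x ∉ Set.Ioo u v) →
      (∀ t ∈ Set.Ioo u v, σ ≤ ∑ i, c i * t ^ β i) ∨
      (∀ t ∈ Set.Ioo u v, ∑ i, c i * t ^ β i ≤ σ) := by
    intro σ
    obtain ⟨S, hS, h⟩ := exists_breakpoints_sum_rpow (Finset.univ : Finset (Option ι))
      (fun o ↦ o.elim (-σ) c) (fun o ↦ o.elim 0 β)
    refine ⟨S, by simpa using hS, fun u v hu hd ↦ ?_⟩
    simpa [Fintype.sum_option] using h u v hu hd
  obtain ⟨S, hS, h⟩ := key τ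
  obtain ⟨S', hS', h'⟩ := key (-τ)
  refine ⟨S ∪ S', (Finset.card_union_le _ _).trans (by omega), fun u v hu hd ↦ ?_⟩
  rcases h u v hu fun x hx ↦ hd x (Finset.mem_union_left _ hx) with h1 | h1
  · exact Or.inl fun t ht ↦ (h1 t ht).trans (le_abs_self _)
  rcases h' u v hu fun x hx ↦ hd x (Finset.mem_union_right _ hx) with h2 | h2
  · exact Or.inr fun t ht ↦ abs_le.2 ⟨h2 t ht, h1 t ht⟩
  · exact Or.inl fun t ht ↦ (le_neg_of_le_neg (h2 t ht)).trans (neg_le_abs _)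

lemma rpow_le_two_rpow_abs_mul {x y : ℝ} (hx : 0 < x) (hy : 0 < y) (hxy : x ≤ 2 * y)
    (hyx : y ≤ 2 * x) (a : ℝ) : x ^ a ≤ 2 ^ |a| * y ^ a := by
  rcases le_total 0 a with ha | ha
  · rw [abs_of_nonneg ha, ← mul_rpow zero_le_two hy.le]
    exact rpow_le_rpow hx.le hxy ha
  · rw [abs_of_nonpos ha, rpow_neg zero_le_two, ← inv_rpow zero_le_two,
      ← mul_rpow (by norm_num) hy.le]
    exact rpow_le_rpow_of_nonpos (by positivity) (by linarith) ha

/-- If the weighted derivative `t ^ (-a) * (t ^ a * f)'` is at least `τ` in absolute value, then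
`f` can only be at most `η * τ` in absolute value on an interval of length `O(η)`. -/
lemma length_le_of_weighted_deriv {f g : ℝ → ℝ} {a u v η τ : ℝ} (hu : 0 < u) (huv : u < v)
    (hτ : 0 < τ)
    (hd : ∀ t > 0, HasDerivAt (fun t ↦ t ^ a * f t) (t ^ a * g t) t)
    (hg : ∀ t ∈ Set.Ioo u v, τ ≤ |g t|) (hf : ∀ t ∈ Set.Ioo u v, |f t| ≤ η * τ) :
    v - u ≤ 8 * 2 ^ |a| * η := by
  obtain ⟨p, hp⟩ : ∃ p, p = (u + v) / 2 := ⟨_, rfl⟩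
  obtain ⟨q, hq⟩ : ∃ q, q = (u + 3 * v) / 4 := ⟨_, rfl⟩
  have hp0 : 0 < p := by linarith
  have hpq : p < q := by linarith
  obtain ⟨ξ, ⟨hξ1, hξ2⟩, hξ⟩ := exists_hasDerivAt_eq_slope (fun t ↦ t ^ a * f t)
    (fun t ↦ t ^ a * g t) hpq
    (fun t ht ↦ (hd t (hp0.trans_le ht.1)).continuousAt.continuousWithinAt)
    (fun t ht ↦ hd t (hp0.trans ht.1))
  have hξ0 : 0 < ξ := hp0.trans hξ1
  rw [eq_div_iff (by linarith)] at hξ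
  have hbound : ∀ x, u < x → x < v → x ≤ 2 * ξ → ξ ≤ 2 * x →
      |x ^ a * f x| ≤ 2 ^ |a| * ξ ^ a * (η * τ) := by
    intro x hx1 hx2 h1 h2
    have hx0 : 0 < x := hu.trans hx1
    rw [abs_mul, abs_of_pos (rpow_pos_of_pos hx0 a)]
    exact mul_le_mul (rpow_le_two_rpow_abs_mul hx0 hξ0 h1 h2 a) (hf x ⟨hx1, hx2⟩)
      (abs_nonneg _) (by positivity)
  have h1 := hbound p (by linarith) (by linarith) (by linarith) (by linarith)
  have h2 := hbound q (by linarith) (by linarith) (by linarith) (by linarith)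
  have h3 : ξ ^ a * τ * (q - p) ≤ |q ^ a * f q - p ^ a * f p| := by
    rw [← hξ, abs_mul, abs_mul, abs_of_pos (rpow_pos_of_pos hξ0 a),
      abs_of_pos (sub_pos.2 hpq)]
    have := hg ξ ⟨by linarith, by linarith⟩
    have := sub_pos.2 hpq
    gcongr
  have h4 := h3.trans (abs_sub _ _)
  have h5 : ξ ^ a * τ * (q - p) ≤ ξ ^ a * τ * (2 * 2 ^ |a| * η) := by linarith
  have h6 := le_of_mul_le_mul_left h5 (mul_pos (rpow_pos_of_pos hξ0 a) hτ)
  linarith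

lemma length_le_or_le_abs_of_weighted_derivs {f : ℕ → ℝ → ℝ} {a : ℕ → ℝ} {u v η K : ℝ}
    (hu : 0 < u) (huv : u < v) (hη : 0 < η)
    (hd : ∀ j, ∀ t > 0, HasDerivAt (fun t ↦ t ^ a j * f j t) (t ^ a j * f (j + 1) t) t) (n : ℕ)
    (hK : ∀ j < n, 8 * 2 ^ |a j| ≤ K)
    (hsplit : ∀ j < n, (∀ t ∈ Set.Ioo u v, η⁻¹ ^ (j + 1) ≤ |f j t|) ∨
      (∀ t ∈ Set.Ioo u v, |f j t| ≤ η⁻¹ ^ (j + 1)))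
    (htop : ∀ t ∈ Set.Ioo u v, η⁻¹ ^ (n + 1) ≤ |f n t|) :
    v - u ≤ K * η ∨ ∀ t ∈ Set.Ioo u v, η⁻¹ ≤ |f 0 t| := by
  induction n with
  | zero => right; simpa using htop
  | succ n ih =>
    rcases hsplit n n.lt_succ_self with h | h
    · exact ih (fun j hj ↦ hK j (hj.trans n.lt_succ_self))
        (fun j hj ↦ hsplit j (hj.trans n.lt_succ_self)) h
    · left
      refine (length_le_of_weighted_deriv (τ := η⁻¹ ^ (n + 1 + 1)) (η := η) hu huv
        (by positivity) (hd n) htop fun t ht ↦ (h t ht).trans_eq ?_).trans ?_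
      · rw [pow_succ' _ (n + 1), mul_inv_cancel_left₀ hη.ne']
      · exact mul_le_mul_of_nonneg_right (hK n n.lt_succ_self) hη.le

/-- Van der Corput's estimate for phases with large monotone derivative. -/
lemma norm_integral_cexp_le_of_le_abs_deriv {φ φ' φ'' : ℝ → ℝ} {u v τ : ℝ} (huv : u ≤ v)
    (hτ : 0 < τ) (h1 : ∀ t ∈ Set.Icc u v, HasDerivAt φ (φ' t) t)
    (h2 : ∀ t ∈ Set.Icc u v, HasDerivAt φ' (φ'' t) t) (hc : ContinuousOn φ'' (Set.Icc u v))
    (hlow : ∀ t ∈ Set.Icc u v, τ ≤ |φ' t|)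
    (hsign : (∀ t ∈ Set.Icc u v, 0 ≤ φ'' t) ∨ ∀ t ∈ Set.Icc u v, φ'' t ≤ 0) :
    ‖∫ t in u..v, Complex.exp (Complex.I * φ t)‖ ≤ 4 * τ⁻¹ := by
  rw [← Set.uIcc_of_le huv] at *
  have hne : ∀ t ∈ Set.uIcc u v, φ' t ≠ 0 := fun t ht ↦ abs_pos.1 (hτ.trans_le (hlow t ht))
  have hinv : ∀ t ∈ Set.uIcc u v, |(φ' t)⁻¹| ≤ τ⁻¹ := fun t ht ↦ by
    rw [abs_inv]; exact inv_anti₀ hτ (hlow t ht)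
  have hdinv : ∀ t ∈ Set.uIcc u v, HasDerivAt (fun t ↦ (φ' t)⁻¹) (-φ'' t / φ' t ^ 2) t :=
    fun t ht ↦ (h2 t ht).inv (hne t ht)
  have hc1 : ContinuousOn φ' (Set.uIcc u v) := fun t ht ↦ (h2 t ht).continuousAt.continuousWithinAt
  have hc0 : ContinuousOn φ (Set.uIcc u v) := fun t ht ↦ (h1 t ht).continuousAt.continuousWithinAt
  have hcq : ContinuousOn (fun t ↦ -φ'' t / φ' t ^ 2) (Set.uIcc u v) :=
    hc.neg.div (hc1.pow 2) fun t ht ↦ pow_ne_zero 2 (hne t ht)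
  have hce : ContinuousOn (fun t ↦ Complex.exp (Complex.I * φ t)) (Set.uIcc u v) :=
    (continuousOn_const.mul (Complex.continuous_ofReal.comp_continuousOn hc0)).cexp
  have hparts := intervalIntegral.integral_mul_deriv_eq_deriv_mul
    (u := fun t ↦ (((φ' t)⁻¹ : ℝ) : ℂ)) (u' := fun t ↦ ((-φ'' t / φ' t ^ 2 : ℝ) : ℂ))
    (v := fun t ↦ -Complex.I * Complex.exp (Complex.I * φ t))
    (v' := fun t ↦ φ' t * Complex.exp (Complex.I * φ t))
    (fun t ht ↦ (hdinv t ht).ofReal_comp)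
    (fun t ht ↦ by
      convert ((((h1 t ht).ofReal_comp).const_mul Complex.I).cexp).const_mul (-Complex.I) using 1
      linear_combination ((φ' t : ℂ) * Complex.exp (Complex.I * φ t)) * Complex.I_mul_I)
    (Complex.continuous_ofReal.comp_continuousOn hcq).intervalIntegrable
    ((Complex.continuous_ofReal.comp_continuousOn hc1).mul hce).intervalIntegrable
  have hnorm : ∀ t, ‖Complex.exp (Complex.I * φ t)‖ = 1 := fun t ↦ by
    rw [mul_comm]; exact Complex.norm_exp_ofReal_mul_I _
  have hlhs : ∫ t in u..v, Complex.exp (Complex.I * φ t) =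
      ∫ t in u..v, (((φ' t)⁻¹ : ℝ) : ℂ) * (φ' t * Complex.exp (Complex.I * φ t)) := by
    refine intervalIntegral.integral_congr fun t ht ↦ ?_
    have : (φ' t : ℂ) ≠ 0 := by exact_mod_cast hne t ht
    simp only [Complex.ofReal_inv]
    rw [inv_mul_cancel_left₀ this]
  have hvar : ∫ t in u..v, -φ'' t / φ' t ^ 2 = (φ' v)⁻¹ - (φ' u)⁻¹ :=
    intervalIntegral.integral_eq_sub_of_hasDerivAt hdinv hcq.intervalIntegrable
  have hu := hinv u Set.left_mem_uIcc
  have hv := hinv v Set.right_mem_uIcc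
  have habs : ∫ t in u..v, |(-φ'' t / φ' t ^ 2)| ≤ 2 * τ⁻¹ := by
    rcases hsign with h | h
    · have : ∫ t in u..v, |(-φ'' t / φ' t ^ 2)| = -∫ t in u..v, -φ'' t / φ' t ^ 2 := by
        rw [← intervalIntegral.integral_neg]
        refine intervalIntegral.integral_congr fun t ht ↦ abs_of_nonpos ?_
        exact div_nonpos_of_nonpos_of_nonneg (neg_nonpos.2 (h t ht)) (sq_nonneg _)
      rw [this, hvar]
      linarith [abs_le.1 hu, abs_le.1 hv]
    · have : ∫ t in u..v, |(-φ'' t / φ' t ^ 2)| = ∫ t in u..v, -φ'' t / φ' t ^ 2 :=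
        intervalIntegral.integral_congr fun t ht ↦
          abs_of_nonneg (div_nonneg (neg_nonneg.2 (h t ht)) (sq_nonneg _))
      rw [this, hvar]
      linarith [abs_le.1 hu, abs_le.1 hv]
  have hrest : ‖∫ t in u..v, ((-φ'' t / φ' t ^ 2 : ℝ) : ℂ) *
      (-Complex.I * Complex.exp (Complex.I * φ t))‖ ≤ 2 * τ⁻¹ := by
    refine (intervalIntegral.norm_integral_le_integral_norm huv).trans (le_trans (le_of_eq ?_) habs)
    refine intervalIntegral.integral_congr fun t _ ↦ ?_
    simp only [norm_mul, norm_neg, Complex.norm_I, hnorm, mul_one, Complex.norm_real,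
      Real.norm_eq_abs]
  have hbdry : ∀ t, ‖(((φ' t)⁻¹ : ℝ) : ℂ) * (-Complex.I * Complex.exp (Complex.I * φ t))‖ =
      |(φ' t)⁻¹| := fun t ↦ by
    simp only [norm_mul, norm_neg, Complex.norm_I, hnorm, mul_one, Complex.norm_real,
      Real.norm_eq_abs]
  rw [hlhs, hparts]
  refine (norm_sub_le _ _).trans ?_
  have := norm_sub_le ((((φ' v)⁻¹ : ℝ) : ℂ) * (-Complex.I * Complex.exp (Complex.I * φ v)))
    ((((φ' u)⁻¹ : ℝ) : ℂ) * (-Complex.I * Complex.exp (Complex.I * φ u)))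
  rw [hbdry, hbdry] at this
  linarith

/-- An integral is controlled by a bound on the subintervals avoiding finitely many points. -/
lemma norm_integral_le_of_breakpoints {F : ℝ → ℂ} (hF : Continuous F) {a b B : ℝ} (hab : a ≤ b)
    (S : Finset ℝ) (h : ∀ u v, a ≤ u → u ≤ v → v ≤ b → (∀ x ∈ S, x ∉ Set.Ioo u v) →
      ‖∫ t in u..v, F t‖ ≤ B) :
    ‖∫ t in a..b, F t‖ ≤ 2 ^ S.card * B := by
  classical
  induction S using Finset.induction_on generalizing B with
  | empty => simpa using h a b le_rfl hab le_rfl (by simp)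
  | insert s S hs ih =>
    rw [Finset.card_insert_of_notMem hs, pow_succ, mul_assoc]
    refine ih fun u v hau huv hvb hd ↦ ?_
    have hB : 0 ≤ B := (norm_nonneg _).trans
      (h a a le_rfl le_rfl hab (by simp))
    by_cases hsuv : s ∈ Set.Ioo u v
    · rw [← intervalIntegral.integral_add_adjacent_intervals
        (hF.intervalIntegrable u s) (hF.intervalIntegrable s v), two_mul]
      refine (norm_add_le _ _).trans (add_le_add ?_ ?_)
      · refine h u s hau hsuv.1.le (hsuv.2.le.trans hvb) fun x hx hxm ↦ ?_
        rcases Finset.mem_insert.1 hx with rfl | hx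
        · exact lt_irrefl _ hxm.2
        · exact hd x hx ⟨hxm.1, hxm.2.trans hsuv.2⟩
      · refine h s v (hau.trans hsuv.1.le) hsuv.2.le hvb fun x hx hxm ↦ ?_
        rcases Finset.mem_insert.1 hx with rfl | hx
        · exact lt_irrefl _ hxm.1
        · exact hd x hx ⟨hsuv.1.trans hxm.1, hxm.2⟩
    · refine (h u v hau huv hvb fun x hx ↦ ?_).trans (by linarith)
      rcases Finset.mem_insert.1 hx with rfl | hx
      · exact hsuv
      · exact hd x hx

/-- Applying `t ^ (-a) * (t ^ a * ·)'` repeatedly to the derivative of a generalized polynomial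
multiplies its coefficients by linear factors in the exponents. -/
lemma hasDerivAt_rpow_mul_sum_prod {ι : Type*} [Fintype ι] (b c : ι → ℝ) (β : ℕ → ℝ) (j : ℕ)
    {t : ℝ} (ht : 0 < t) :
    HasDerivAt (fun t ↦ t ^ (j + 1 - β j) *
        ∑ i, c i * b i * (∏ k ∈ Finset.range j, (b i - β k)) * t ^ (b i - 1 - j))
      (t ^ (j + 1 - β j) * ∑ i, c i * b i * (∏ k ∈ Finset.range (j + 1), (b i - β k)) *
        t ^ (b i - 1 - (j + 1 : ℕ))) t := by
  have hd : HasDerivAt (fun t ↦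
      ∑ i, c i * b i * (∏ k ∈ Finset.range j, (b i - β k)) * t ^ (b i - β j))
      (∑ i, c i * b i * (∏ k ∈ Finset.range j, (b i - β k)) *
        ((b i - β j) * t ^ (b i - β j - 1))) t :=
    HasDerivAt.fun_sum fun i _ ↦ (hasDerivAt_rpow_const (Or.inl ht.ne')).const_mul _
  refine (hd.congr_of_eventuallyEq ?_).congr_deriv ?_
  · filter_upwards [lt_mem_nhds ht] with x hx
    rw [Finset.mul_sum]
    refine Finset.sum_congr rfl fun i _ ↦ ?_
    rw [mul_left_comm, ← rpow_add hx]
    ring_nf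
  · rw [Finset.mul_sum]
    refine Finset.sum_congr rfl fun i _ ↦ ?_
    rw [mul_left_comm (t ^ (j + 1 - β j) : ℝ), ← rpow_add ht, Finset.prod_range_succ]
    push_cast
    ring_nf

lemma hasDerivAt_sum_mul_rpow {ι : Type*} [Fintype ι] (c β : ι → ℝ) {t : ℝ} (ht : 0 < t) :
    HasDerivAt (fun t ↦ ∑ i, c i * t ^ β i) (∑ i, c i * β i * t ^ (β i - 1)) t :=
  HasDerivAt.fun_sum fun _ _ ↦ by
    rw [mul_assoc]
    exact (hasDerivAt_rpow_const (Or.inl ht.ne')).const_mul _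

lemma continuousOn_sum_mul_rpow {ι : Type*} [Fintype ι] (c β : ι → ℝ) {s : Set ℝ}
    (hs : ∀ t ∈ s, 0 < t) : ContinuousOn (fun t ↦ ∑ i, c i * t ^ β i) s :=
  continuousOn_finsetSum _ fun _ _ ↦ continuousOn_const.mul
    (continuousOn_id.rpow_const fun t ht ↦ Or.inl (hs t ht).ne')

/-- Van der Corput's estimate for generalized polynomials, the `(n + 1)`-st derivative being
replaced by the image of the derivative under `n` weighted differentiations. -/
lemma exists_norm_integral_cexp_sum_rpow_le {ι : Type*} [Fintype ι] (b : ι → ℝ)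
    (hb : ∀ i, 0 < b i) (β : ℕ → ℝ) (n : ℕ) :
    ∃ K : ℝ, 0 < K ∧ ∀ (c : ι → ℝ) (x y η : ℝ), 0 < x → x ≤ y → 0 < η →
      (∀ t ∈ Set.Ioo x y, η⁻¹ ^ (n + 1) ≤
        |∑ i, c i * b i * (∏ k ∈ Finset.range n, (b i - β k)) * t ^ (b i - 1 - n)|) →
      ‖∫ t in x..y, Complex.exp (Complex.I * (∑ i, c i * t ^ b i : ℝ))‖ ≤ K * η := by
  classical
  set M : ℝ := ∑ j ∈ Finset.range n, 8 * 2 ^ |(j + 1 - β j : ℝ)| with hM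
  have hM0 : 0 ≤ M := Finset.sum_nonneg fun j _ ↦ by positivity
  set N : ℕ := Fintype.card ι + n * (2 * (Fintype.card ι + 1)) with hN
  refine ⟨2 ^ N * (M + 4), by positivity, fun c x y η hx hxy hη htop ↦ ?_⟩
  set f : ℕ → ℝ → ℝ := fun j t ↦
    ∑ i, c i * b i * (∏ k ∈ Finset.range j, (b i - β k)) * t ^ (b i - 1 - j) with hf
  have hf0 : ∀ t, f 0 t = ∑ i, c i * b i * t ^ (b i - 1) := fun t ↦ by simp [hf]
  choose S hS hSsplit using fun j : ℕ ↦ exists_breakpoints_abs_sum_rpow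
    (fun i ↦ c i * b i * ∏ k ∈ Finset.range j, (b i - β k)) (fun i ↦ b i - 1 - j) (η⁻¹ ^ (j + 1))
  obtain ⟨S₂, hS₂, hS₂split⟩ := exists_breakpoints_sum_rpow Finset.univ
    (fun i ↦ c i * b i * (b i - 1)) (fun i ↦ b i - 1 - 1)
  set T := S₂ ∪ (Finset.range n).biUnion S with hT
  have hTcard : T.card ≤ N := by
    refine (Finset.card_union_le _ _).trans (add_le_add hS₂ ?_)
    simpa using Finset.card_biUnion_le_card_mul (Finset.range n) S _ fun j _ ↦ hS j
  have hcont : Continuous fun t : ℝ ↦ Complex.exp (Complex.I * (∑ i, c i * t ^ b i : ℝ)) := by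
    refine (continuous_const.mul (Complex.continuous_ofReal.comp ?_)).cexp
    exact continuous_finsetSum _ fun i _ ↦
      continuous_const.mul (continuous_id.rpow_const fun _ ↦ Or.inr (hb i).le)
  have hnorm : ∀ t : ℝ, ‖Complex.exp (Complex.I * (∑ i, c i * t ^ b i : ℝ))‖ ≤ 1 := fun t ↦ by
    rw [mul_comm]; exact (Complex.norm_exp_ofReal_mul_I _).le
  have hpiece : ∀ u v, x ≤ u → u ≤ v → v ≤ y → (∀ z ∈ T, z ∉ Set.Ioo u v) →
      ‖∫ t in u..v, Complex.exp (Complex.I * (∑ i, c i * t ^ b i : ℝ))‖ ≤ (M + 4) * η := by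
    intro u v hxu huv hvy hd
    rcases huv.eq_or_lt with rfl | huv'
    · simpa using by positivity
    have hu : 0 < u := hx.trans_le hxu
    have hpos : ∀ t ∈ Set.Icc u v, 0 < t := fun t ht ↦ hu.trans_le ht.1
    have hclos : closure (Set.Ioo u v) = Set.Icc u v := closure_Ioo huv'.ne
    rcases length_le_or_le_abs_of_weighted_derivs (f := f) (a := fun j ↦ j + 1 - β j) (K := M)
      hu huv' hη (fun j t ht ↦ hasDerivAt_rpow_mul_sum_prod b c β j ht) n
      (fun j hj ↦ Finset.single_le_sum (f := fun j : ℕ ↦ 8 * 2 ^ |(j + 1 - β j : ℝ)|)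
        (fun i _ ↦ by positivity) (Finset.mem_range.2 hj))
      (fun j hj ↦ hSsplit j u v hu.le fun z hz ↦ hd z (Finset.mem_union_right _
        (Finset.mem_biUnion.2 ⟨j, Finset.mem_range.2 hj, hz⟩)))
      (fun t ht ↦ htop t ⟨hxu.trans_lt ht.1, ht.2.trans_le hvy⟩) with h | h
    · refine (intervalIntegral.norm_integral_le_of_norm_le_const fun t _ ↦ hnorm t).trans ?_
      rw [one_mul, abs_of_pos (sub_pos.2 huv')]
      linarith
    · have hc1 := continuousOn_sum_mul_rpow (fun i ↦ c i * b i) (fun i ↦ b i - 1) hpos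
      have hc2 := continuousOn_sum_mul_rpow (fun i ↦ c i * b i * (b i - 1))
        (fun i ↦ b i - 1 - 1) hpos
      have := norm_integral_cexp_le_of_le_abs_deriv huv (inv_pos.2 hη)
        (fun t ht ↦ hasDerivAt_sum_mul_rpow c b (hpos t ht))
        (fun t ht ↦ hasDerivAt_sum_mul_rpow (fun i ↦ c i * b i) (fun i ↦ b i - 1) (hpos t ht))
        hc2
        (fun t ht ↦ by
          rw [← hclos] at ht hc1
          exact le_on_closure (fun z hz ↦ (h z hz).trans_eq (congrArg _ (hf0 z)))
            continuousOn_const hc1.abs ht)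
        (by
          rw [← hclos] at hc2 ⊢
          exact (hS₂split u v hu.le fun z hz ↦ hd z (Finset.mem_union_left _ hz)).imp
            (fun h t ht ↦ le_on_closure h continuousOn_const hc2 ht)
            (fun h t ht ↦ le_on_closure h hc2 continuousOn_const ht))
      rw [inv_inv] at this
      exact this.trans (by nlinarith)
  refine (norm_integral_le_of_breakpoints hcont hxy T hpiece).trans ?_
  rw [mul_assoc]
  gcongr
  norm_num

lemma rpow_mul_succ_le_mul_rpow {n : ℕ} {b₀ lam t : ℝ} (hb₀ : 0 < b₀) (hlam : 0 < lam)
    (hlow : lam ^ (-min (1 / b₀) (1 / (n + 1 : ℝ))) ≤ t) (ht1 : t ≤ 1) :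
    lam ^ (min (1 / b₀) (1 / (n + 1 : ℝ)) * (n + 1)) ≤ lam * t ^ (b₀ - 1 - n) := by
  have hn : (0 : ℝ) < n + 1 := by positivity
  have ht : 0 < t := (rpow_pos_of_pos hlam _).trans_le hlow
  rcases le_total b₀ (n + 1) with h | h
  · rw [min_eq_right (one_div_le_one_div_of_le hb₀ h), one_div_mul_cancel hn.ne', rpow_one]
    exact le_mul_of_one_le_right hlam.le
      (one_le_rpow_of_pos_of_le_one_of_nonpos ht ht1 (by linarith))
  · rw [min_eq_left (one_div_le_one_div_of_le hn h)] at hlow ⊢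
    calc lam ^ (1 / b₀ * (n + 1)) = lam * (lam ^ (-(1 / b₀))) ^ (b₀ - 1 - n) := by
          rw [← rpow_mul hlam.le, ← rpow_one_add' hlam.le]
          · congr 1
            field_simp
            ring
          · have : 1 + -(1 / b₀) * (b₀ - 1 - n) = (n + 1) / b₀ := by field_simp; ring
            rw [this]
            positivity
      _ ≤ lam * t ^ (b₀ - 1 - n) := by
          gcongr
          linarith

/-- The Ricci–Stein oscillatory integral estimate for phases with distinct
positive real exponents, uniform in the parameters and in `0 ≤ a < b ≤ 1`. -/
theorem ricci_stein_oscillatory_estimate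
    (n : ℕ) (b : Fin (n + 1) → ℝ)
    (hb_inj : Function.Injective b) (hb_pos : ∀ i, 0 < b i) :
    ∃ C : ℝ, 0 < C ∧
      ∀ (μ : Fin n → ℝ) (a b' : ℝ), 0 ≤ a → a < b' → b' ≤ 1 →
        ∀ lam : ℝ, 0 < lam →
          ‖∫ t in a..b', Complex.exp (Complex.I * lam *
              ((t ^ (b 0) + ∑ i : Fin n, μ i * t ^ (b i.succ) : ℝ) : ℂ))‖
            ≤ C * lam ^ (-(min (1 / b 0) (1 / (n + 1 : ℝ)))) := by
  set β : ℕ → ℝ := fun k ↦ if h : k < n then b (Fin.succ ⟨k, h⟩) else 0 with hβ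
  have hβsucc : ∀ i : Fin n, β i = b i.succ := fun i ↦ dif_pos i.2
  obtain ⟨K, hK, hest⟩ := exists_norm_integral_cexp_sum_rpow_le b hb_pos β n
  set P : ℝ := b 0 * ∏ k ∈ Finset.range n, (b 0 - β k) with hP
  have hP0 : 0 < |P| := by
    refine abs_pos.2 (mul_ne_zero (hb_pos 0).ne' (Finset.prod_ne_zero_iff.2 fun k hk ↦ ?_))
    rw [sub_ne_zero, hβsucc ⟨k, Finset.mem_range.1 hk⟩]
    exact fun h ↦ (Fin.succ_ne_zero _).symm (hb_inj h)
  refine ⟨1 + K * |P| ^ (-(1 / (n + 1 : ℝ))), by positivity, fun μ a b' ha hab hb1 lam hlam ↦ ?_⟩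
  set ε : ℝ := min (1 / b 0) (1 / (n + 1 : ℝ)) with hε
  set c : Fin (n + 1) → ℝ := Fin.cons lam fun i ↦ lam * μ i with hc
  have hint : ∀ t : ℝ, Complex.exp (Complex.I * lam *
      ((t ^ (b 0) + ∑ i : Fin n, μ i * t ^ (b i.succ) : ℝ) : ℂ)) =
      Complex.exp (Complex.I * (∑ i, c i * t ^ b i : ℝ)) := fun t ↦ by
    have : ∑ i, c i * t ^ b i = lam * (t ^ b 0 + ∑ i : Fin n, μ i * t ^ b i.succ) := by
      simp [hc, Fin.sum_univ_succ, mul_add, Finset.mul_sum, mul_assoc]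
    rw [this, Complex.ofReal_mul, mul_assoc]
  simp only [hint]
  have hcont : Continuous fun t : ℝ ↦ Complex.exp (Complex.I * (∑ i, c i * t ^ b i : ℝ)) := by
    refine (continuous_const.mul (Complex.continuous_ofReal.comp ?_)).cexp
    exact continuous_finsetSum _ fun i _ ↦
      continuous_const.mul (continuous_id.rpow_const fun _ ↦ Or.inr (hb_pos i).le)
  have htriv : ∀ u v : ℝ, u ≤ v →
      ‖∫ t in u..v, Complex.exp (Complex.I * (∑ i, c i * t ^ b i : ℝ))‖ ≤ v - u := by
    intro u v huv
    refine (intervalIntegral.norm_integral_le_of_norm_le_const (C := 1) fun t _ ↦ ?_).trans_eq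
      (by rw [one_mul, abs_of_nonneg (sub_nonneg.2 huv)])
    rw [mul_comm]
    exact (Complex.norm_exp_ofReal_mul_I _).le
  have hδ : 0 < lam ^ (-ε) := rpow_pos_of_pos hlam _
  have hlarge : ∀ x, lam ^ (-ε) ≤ x → x ≤ b' →
      ‖∫ t in x..b', Complex.exp (Complex.I * (∑ i, c i * t ^ b i : ℝ))‖ ≤
        K * (|P| ^ (-(1 / (n + 1 : ℝ))) * lam ^ (-ε)) := by
    intro x hx hxb
    refine hest c x b' _ (hδ.trans_le hx) hxb (by positivity) fun t ht ↦ ?_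
    have ht0 : 0 < t := hδ.trans_le (hx.trans ht.1.le)
    have hsum : ∑ i, c i * b i * (∏ k ∈ Finset.range n, (b i - β k)) * t ^ (b i - 1 - n) =
        P * (lam * t ^ (b 0 - 1 - n)) := by
      rw [Fin.sum_univ_succ, Finset.sum_eq_zero, add_zero]
      · simp only [hc, hP, Fin.cons_zero]
        ring
      · intro i _
        rw [Finset.prod_eq_zero (Finset.mem_range.2 i.2) (by rw [hβsucc, sub_self])]
        simp
    have hpow : (|P| ^ (-(1 / (n + 1 : ℝ))) * lam ^ (-ε))⁻¹ ^ (n + 1) =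
        |P| * lam ^ (ε * (n + 1)) := by
      have hn : (n + 1 : ℝ) ≠ 0 := by positivity
      rw [mul_inv, ← rpow_neg hP0.le, ← rpow_neg hlam.le, neg_neg, neg_neg, mul_pow,
        ← rpow_mul_natCast hP0.le, ← rpow_mul_natCast hlam.le]
      push_cast
      rw [one_div_mul_cancel hn, rpow_one]
    rw [hsum, hpow, abs_mul P, abs_of_pos (mul_pos hlam (rpow_pos_of_pos ht0 _))]
    gcongr
    exact rpow_mul_succ_le_mul_rpow (hb_pos 0) hlam (hx.trans ht.1.le) (ht.2.le.trans hb1)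
  rw [add_mul, one_mul, mul_assoc]
  have hnonneg : 0 ≤ K * (|P| ^ (-(1 / (n + 1 : ℝ))) * lam ^ (-ε)) := by positivity
  rcases le_total (lam ^ (-ε)) a with h | h
  · exact (hlarge a h hab.le).trans (by linarith)
  rcases le_total b' (lam ^ (-ε)) with h' | h'
  · exact (htriv a b' hab.le).trans (by linarith)
  · rw [← intervalIntegral.integral_add_adjacent_intervals
      (hcont.intervalIntegrable a (lam ^ (-ε))) (hcont.intervalIntegrable (lam ^ (-ε)) b')]
    exact (norm_add_le _ _).trans (add_le_add ((htriv a _ h).trans (by linarith))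
      (hlarge _ le_rfl h'))
end

section
/- Let γ : ℝ → ℝ^d be a smooth curve of standard type with associated exponents 1 ≤ a₁ < ⋯ < a_d, let α ∈ ℝ and β > 0, and fix a smooth cutoff ϑ supported in {t : 1/2 ≤ |t| ≤ 2}. Then for every N > 0 there exist ε > 0 and a constant C_N such that whenever j ∈ ℕ and ξ ∈ ℝ^d satisfy |2^{-j} ∘_β ξ| ≤ ε, one has |m_j(ξ)| ≤ C_N · 2^{j(α − Nβ)}. -/
open MeasureTheory Real Filter
open scoped Topology ENNReal

/-- A smooth curve `γ : ℝ → ℝ^d` is of *standard type*, with associated exponents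
`a : Fin d → ℕ`, `1 ≤ a₁ < ⋯ < a_d`, if `γ_k(t) = t^{a_k}/a_k! + higher order terms`,
i.e. `γ_k^{(m)}(0) = 0` for `m < a_k` and `γ_k^{(a_k)}(0) = 1`. -/
def IsStandardTypeWith (d : ℕ) (γ : ℝ → Fin d → ℝ) (a : Fin d → ℕ) : Prop :=
  ContDiff ℝ (⊤ : ℕ∞) γ ∧ StrictMono a ∧ (∀ k, 1 ≤ a k) ∧
    ∀ k : Fin d,
      (∀ m : ℕ, m < a k → iteratedDeriv m (fun t => γ t k) 0 = 0) ∧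
      iteratedDeriv (a k) (fun t => γ t k) 0 = 1

/-- The multiplier `m_j(ξ) = 2^{jα} ∫ ϑ(t) t⁻¹ |t|^{-α} e^{i(2^{jβ}|t|^{-β} - ξ·γ(2^{-j}t))} dt`. -/
noncomputable def multiplier (d : ℕ) (γ : ℝ → Fin d → ℝ) (α β : ℝ) (ϑ : ℝ → ℝ)
    (j : ℕ) (ξ : Fin d → ℝ) : ℂ :=
  ((2 : ℝ) ^ ((j : ℝ) * α) : ℝ) •
    ∫ t : ℝ, (ϑ t : ℂ) * (t : ℂ)⁻¹ * ((|t| ^ (-α) : ℝ) : ℂ) *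
      Complex.exp (Complex.I *
        (((2 : ℝ) ^ ((j : ℝ) * β) * |t| ^ (-β)
          - ∑ k, ξ k * γ ((2 : ℝ) ^ (-(j : ℝ)) * t) k : ℝ) : ℂ))

/-- The Euclidean norm of the nonisotropically dilated frequency
`2^{-j} ∘_β ξ = (2^{-j(β+a₁)}ξ₁, …, 2^{-j(β+a_d)}ξ_d)`. -/
noncomputable def dilNorm (d : ℕ) (a : Fin d → ℕ) (β : ℝ) (j : ℕ) (ξ : Fin d → ℝ) : ℝ :=
  Real.sqrt (∑ k, ((2 : ℝ) ^ (-(j : ℝ) * (β + a k)) * ξ k) ^ 2)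


open scoped ContDiff

/-- Differentiation under the integral sign for the averages `∫₀¹ u ^ k * G (x * u) du`. -/
theorem hasDerivAt_integral_pow_mul_comp_mul {G : ℝ → ℝ} (hG : ContDiff ℝ 1 G) (k : ℕ) (x : ℝ) :
    HasDerivAt (fun x => ∫ u in (0 : ℝ)..1, u ^ k * G (x * u))
      (∫ u in (0 : ℝ)..1, u ^ (k + 1) * deriv G (x * u)) x := by
  have hG' : Continuous (deriv G) := hG.continuous_deriv le_rfl
  obtain ⟨C, hC⟩ := ((isCompact_closedBall x 1).prod (isCompact_Icc (a := (0 : ℝ)) (b := 1))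
    ).exists_bound_of_continuousOn
      (f := fun p : ℝ × ℝ => p.2 ^ (k + 1) * deriv G (p.1 * p.2)) (by fun_prop)
  refine (intervalIntegral.hasDerivAt_integral_of_dominated_loc_of_deriv_le
    (F := fun x u => u ^ k * G (x * u)) (F' := fun x u => u ^ (k + 1) * deriv G (x * u))
    (bound := fun _ => C) (Metric.closedBall_mem_nhds x one_pos) ?_ ?_ ?_ ?_ ?_ ?_).2
  · exact Eventually.of_forall fun y =>
      (by have := hG.continuous; fun_prop : Continuous fun u => u ^ k * G (y * u)
        ).aestronglyMeasurable
  · exact (by have := hG.continuous; fun_prop : Continuous fun u => u ^ k * G (x * u)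
      ).intervalIntegrable _ _
  · exact (by fun_prop : Continuous fun u => u ^ (k + 1) * deriv G (x * u)).aestronglyMeasurable
  · refine Eventually.of_forall fun u hu y hy => hC (y, u) ⟨hy, ?_⟩
    rw [Set.uIoc_of_le zero_le_one] at hu
    exact ⟨hu.1.le, hu.2⟩
  · exact intervalIntegrable_const
  · refine Eventually.of_forall fun u _ y _ => ?_
    have h1 : HasDerivAt G (deriv G (y * u)) (y * u) :=
      (hG.differentiable one_ne_zero _).hasDerivAt
    have h2 := (h1.comp y ((hasDerivAt_id y).mul_const u)).const_mul (u ^ k)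
    refine h2.congr_deriv ?_
    ring

theorem contDiff_integral_pow_mul_comp_mul {G : ℝ → ℝ} (hG : ContDiff ℝ ∞ G) (k : ℕ) :
    ContDiff ℝ ∞ (fun x => ∫ u in (0 : ℝ)..1, u ^ k * G (x * u)) := by
  refine contDiff_infty.2 fun n => ?_
  induction n generalizing G k with
  | zero =>
    exact contDiff_zero.2 (continuous_iff_continuousAt.2 fun x =>
      (hasDerivAt_integral_pow_mul_comp_mul (hG.of_le (by simp)) k x).continuousAt)
  | succ n ih =>
    have hd := hasDerivAt_integral_pow_mul_comp_mul (hG.of_le (by simp)) k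
    rw [Nat.cast_succ, contDiff_succ_iff_deriv]
    refine ⟨fun x => (hd x).differentiableAt, by simp, ?_⟩
    rw [funext fun x => (hd x).deriv]
    exact ih (contDiff_infty_iff_deriv.1 hG).2 (k + 1)

/-- Hadamard's lemma: a smooth function vanishing to order `n` at the origin is `x ^ n` times
a smooth function. -/
theorem exists_contDiff_eq_pow_mul {f : ℝ → ℝ} (hf : ContDiff ℝ ∞ f) (n : ℕ)
    (h0 : ∀ m < n, iteratedDeriv m f 0 = 0) :
    ∃ g : ℝ → ℝ, ContDiff ℝ ∞ g ∧ ∀ x, f x = x ^ n * g x := by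
  induction n generalizing f with
  | zero => exact ⟨f, hf, fun x => by simp⟩
  | succ n ih =>
    have hf' := contDiff_infty_iff_deriv.1 hf
    obtain ⟨G, hG, hfG⟩ := ih hf'.2 fun m hm => by
      rw [← iteratedDeriv_succ']
      exact h0 _ (by omega)
    refine ⟨_, contDiff_integral_pow_mul_comp_mul hG n, fun x => ?_⟩
    have hderiv : ∀ u : ℝ, HasDerivAt (fun u => f (x * u)) (x ^ (n + 1) * (u ^ n * G (x * u))) u := by
      intro u
      have h := (hf'.1 (x * u)).hasDerivAt.comp u ((hasDerivAt_id u).const_mul x)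
      refine h.congr_deriv ?_
      rw [hfG]
      ring
    have hcont : Continuous fun u => x ^ (n + 1) * (u ^ n * G (x * u)) := by
      have := hG.continuous
      fun_prop
    have hint := intervalIntegral.integral_eq_sub_of_hasDerivAt (a := 0) (b := 1)
      (fun u _ => hderiv u) (hcont.intervalIntegrable _ _)
    have hf0 : f 0 = 0 := by simpa using h0 0 n.succ_pos
    simp only [mul_one, mul_zero, hf0, sub_zero, intervalIntegral.integral_const_mul] at hint
    exact hint.symm

/-- A function on `ℝ × V` that is continuous on an open set and vanishes outside `A × V` has
continuous slices over those parameters `v` for which `A × {v}` lies in the open set. -/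
theorem continuous_slice_of_eq_zero {V : Type*} [TopologicalSpace V] {U : Set (ℝ × V)}
    (hU : IsOpen U) {A : Set ℝ} (hA : IsClosed A) {F : ℝ × V → ℂ} (hF : ContinuousOn F U)
    (hF0 : ∀ t v, t ∉ A → F (t, v) = 0) {v : V} (hv : ∀ t ∈ A, (t, v) ∈ U) :
    Continuous fun t => F (t, v) := by
  refine continuous_iff_continuousAt.2 fun t => ?_
  by_cases ht : t ∈ A
  · have h := hF.continuousAt (hU.mem_nhds (hv t ht))
    exact ContinuousAt.comp (f := fun t => (t, v)) h (by fun_prop)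
  · refine ContinuousAt.congr (f := fun _ => (0 : ℂ)) continuousAt_const ?_
    filter_upwards [hA.isOpen_compl.mem_nhds ht] with s hs
    exact (hF0 s v hs).symm

/-- Nonstationary phase, uniformly over a compact set of parameters. -/
theorem exists_norm_integral_exp_le {V : Type*} [NormedAddCommGroup V] [NormedSpace ℝ V]
    {U : Set (ℝ × V)} (hU : IsOpen U) {A : Set ℝ}
    (hA : IsCompact A) {K : Set V} (hK : IsCompact K) (hAK : A ×ˢ K ⊆ U) {φ : ℝ × V → ℝ}
    (hφ : ContDiffOn ℝ ∞ φ U) (hφ' : ∀ p ∈ U, fderiv ℝ φ p (1, 0) ≠ 0) (n : ℕ)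
    {u : ℝ × V → ℂ} (hu : ContDiffOn ℝ ∞ u U) (hu0 : ∀ t v, t ∉ A → u (t, v) = 0) :
    ∃ C : ℝ, ∀ l : ℝ, 0 < l → ∀ v ∈ K,
      ‖∫ t, u (t, v) * Complex.exp (Complex.I * ((l * φ (t, v) : ℝ) : ℂ))‖ ≤ C * (l ^ n)⁻¹ := by
  induction n generalizing u with
  | zero =>
    obtain ⟨C, hC⟩ := (hA.prod hK).exists_bound_of_continuousOn (hu.continuousOn.mono hAK)
    refine ⟨C * volume.real A, fun l _ v hv => ?_⟩
    rw [← setIntegral_eq_integral_of_forall_compl_eq_zero (s := A)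
      (fun t ht => by rw [hu0 t v ht, zero_mul])]
    have := norm_setIntegral_le_of_norm_le_const (μ := volume) (s := A)
      (f := fun t => u (t, v) * Complex.exp (Complex.I * ((l * φ (t, v) : ℝ) : ℂ))) (C := C)
      hA.measure_lt_top (fun t ht => by
        rw [norm_mul, mul_comm Complex.I, Complex.norm_exp_ofReal_mul_I, mul_one]
        exact hC (t, v) ⟨ht, hv⟩)
    simpa using this
  | succ n ih =>
    set ψ : ℝ × V → ℝ := fun p => fderiv ℝ φ p (1, 0) with hψdef
    set q : ℝ × V → ℂ := fun p => ((ψ p)⁻¹ : ℝ) • u p with hqdef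
    have hψ : ContDiffOn ℝ ∞ ψ U :=
      (hφ.fderiv_of_isOpen hU (m := ∞) (by simp)).clm_apply contDiffOn_const
    have hq : ContDiffOn ℝ ∞ q U := (hψ.inv hφ').smul hu
    have hq0 : ∀ t v, t ∉ A → q (t, v) = 0 := fun t v ht => by simp [hqdef, hu0 t v ht]
    have hw : ContDiffOn ℝ ∞ (fun p => fderiv ℝ q p (1, 0)) U :=
      (hq.fderiv_of_isOpen hU (m := ∞) (by simp)).clm_apply contDiffOn_const
    have hqev : ∀ t v, t ∉ A → q =ᶠ[𝓝 (t, v)] fun _ => 0 := fun t v ht => by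
      filter_upwards [(hA.isClosed.isOpen_compl.preimage continuous_fst).mem_nhds
        (show (t, v) ∈ Prod.fst ⁻¹' Aᶜ from ht)] with p hp
      exact hq0 p.1 p.2 hp
    have hw0 : ∀ t v, t ∉ A → fderiv ℝ q (t, v) (1, 0) = 0 := fun t v ht => by
      rw [(hqev t v ht).fderiv_eq]
      simp
    obtain ⟨C, hC⟩ := ih hw hw0
    refine ⟨C, fun l hl v hv => ?_⟩
    set e : ℝ → ℂ := fun t => Complex.exp (Complex.I * ((l * φ (t, v) : ℝ) : ℂ)) with hedef
    have hmem : ∀ t ∈ A, (t, v) ∈ U := fun t ht => hAK ⟨ht, hv⟩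
    have hcont : ∀ F : ℝ × V → ℂ, ContDiffOn ℝ ∞ F U → (∀ t v, t ∉ A → F (t, v) = 0) →
        Integrable fun t => F (t, v) * e t := by
      intro F hF hF0
      refine (continuous_slice_of_eq_zero hU hA.isClosed
        (F := fun p => F p * Complex.exp (Complex.I * ((l * φ p : ℝ) : ℂ))) ?_
        (fun t v ht => by rw [hF0 t v ht, zero_mul]) hmem).integrable_of_hasCompactSupport ?_
      · have h1 := hF.continuousOn
        have h2 := hφ.continuousOn
        fun_prop
      · exact HasCompactSupport.intro hA fun t ht => by rw [hF0 t v ht, zero_mul]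
    have hderiv : ∀ t, HasDerivAt (fun t => q (t, v) * e t)
        (fderiv ℝ q (t, v) (1, 0) * e t + Complex.I * l * (u (t, v) * e t)) t := by
      intro t
      by_cases ht : t ∈ A
      · have hline : HasDerivAt (fun t : ℝ => (t, v)) ((1 : ℝ), (0 : V)) t :=
          (hasDerivAt_id t).prodMk (hasDerivAt_const t v)
        have hnhds := hU.mem_nhds (hmem t ht)
        have h1 : HasDerivAt (fun t => q (t, v)) (fderiv ℝ q (t, v) (1, 0)) t :=
          HasFDerivAt.comp_hasDerivAt (l := q) t
            ((hq.contDiffAt hnhds).differentiableAt (by simp)).hasFDerivAt hline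
        have h2 : HasDerivAt (fun t => φ (t, v)) (ψ (t, v)) t :=
          HasFDerivAt.comp_hasDerivAt (l := φ) t
            ((hφ.contDiffAt hnhds).differentiableAt (by simp)).hasFDerivAt hline
        have h3 := ((h2.const_mul l).ofReal_comp.const_mul Complex.I).cexp
        refine (h1.mul h3).congr_deriv ?_
        have hne : ((ψ (t, v) : ℝ) : ℂ) ≠ 0 := by exact_mod_cast hφ' _ (hmem t ht)
        simp only [hqdef, hedef, Complex.real_smul]
        push_cast
        field_simp
      · rw [hw0 t v ht, hu0 t v ht]
        simp only [zero_mul, mul_zero, add_zero]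
        refine (hasDerivAt_const t (0 : ℂ)).congr_of_eventuallyEq ?_
        filter_upwards [hA.isClosed.isOpen_compl.mem_nhds ht] with s hs
        rw [hq0 s v hs, zero_mul]
    have hzero := integral_eq_zero_of_hasDerivAt_of_integrable hderiv
      ((hcont _ hw hw0).add ((hcont u hu hu0).const_mul _)) (hcont q hq hq0)
    rw [integral_add (hcont _ hw hw0) ((hcont u hu hu0).const_mul _), integral_const_mul] at hzero
    have hnorm : l * ‖∫ t, u (t, v) * e t‖ = ‖∫ t, fderiv ℝ q (t, v) (1, 0) * e t‖ := by
      rw [eq_neg_of_add_eq_zero_left hzero, norm_neg, norm_mul, norm_mul, Complex.norm_I, one_mul,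
        Complex.norm_real, Real.norm_of_nonneg hl.le]
    have hb := hC l hl v hv
    rw [← hnorm] at hb
    calc ‖∫ t, u (t, v) * e t‖ = l⁻¹ * (l * ‖∫ t, u (t, v) * e t‖) := by field_simp
      _ ≤ l⁻¹ * (C * (l ^ n)⁻¹) := by gcongr
      _ = C * (l ^ (n + 1))⁻¹ := by rw [pow_succ, mul_inv]; ring

theorem deriv_abs_rpow_ne_zero {β : ℝ} (hβ : β ≠ 0) {t : ℝ} (ht : t ≠ 0) :
    deriv (fun t : ℝ => |t| ^ (-β)) t ≠ 0 := by
  have h := ((hasDerivAt_abs ht).rpow_const (p := -β) (Or.inl (abs_ne_zero.2 ht))).deriv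
  rw [h]
  have h1 : (SignType.sign t : ℝ) ≠ 0 := by
    rcases lt_or_gt_of_ne ht with h | h <;> simp [h]
  have h2 := (Real.rpow_pos_of_pos (abs_pos.2 ht) (-β - 1)).ne'
  exact mul_ne_zero (mul_ne_zero h1 (neg_ne_zero.2 hβ)) h2

/-- In the low-frequency regime `|2^{-j} ∘_β ξ| ≤ ε` the multiplier has rapid decay:
for every `N > 0` there are `ε > 0` and `C_N` with `|m_j(ξ)| ≤ C_N 2^{j(α - Nβ)}`. -/
theorem low_frequency_rapid_decay
    (d : ℕ) (hd : 0 < d) (γ : ℝ → Fin d → ℝ) (a : Fin d → ℕ)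
    (hγ : IsStandardTypeWith d γ a) (α β : ℝ) (hβ : 0 < β)
    (ϑ : ℝ → ℝ) (hϑ : ContDiff ℝ (⊤ : ℕ∞) ϑ)
    (hsupp : tsupport ϑ ⊆ {t : ℝ | 1 / 2 ≤ |t| ∧ |t| ≤ 2}) :
    ∀ N : ℝ, 0 < N → ∃ ε : ℝ, 0 < ε ∧ ∃ C : ℝ, 0 < C ∧
      ∀ (j : ℕ) (ξ : Fin d → ℝ), dilNorm d a β j ξ ≤ ε →
        ‖multiplier d γ α β ϑ j ξ‖ ≤ C * (2 : ℝ) ^ ((j : ℝ) * (α - N * β)) := by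
  intro N hN
  obtain ⟨hγs, -, -, hγ0⟩ := hγ
  choose g hg hγg using fun k => exists_contDiff_eq_pow_mul (contDiff_pi.1 hγs k) (a k) (hγ0 k).1
  set A : Set ℝ := {t : ℝ | 1 / 2 ≤ |t| ∧ |t| ≤ 2} with hAdef
  have hA : IsCompact A := by
    refine (isCompact_Icc (a := (-2 : ℝ)) (b := 2)).of_isClosed_subset ?_ fun t ht => abs_le.1 ht.2
    exact (isClosed_le continuous_const continuous_abs).inter
      (isClosed_le continuous_abs continuous_const)
  have hAne : ∀ t ∈ A, t ≠ 0 := by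
    rintro t ⟨ht, -⟩ rfl
    norm_num at ht
  set φ : ℝ × ℝ × (Fin d → ℝ) → ℝ := fun p =>
    |p.1| ^ (-β) - ∑ k, p.2.2 k * (p.1 ^ a k * g k (p.2.1 * p.1)) with hφdef
  set u : ℝ × ℝ × (Fin d → ℝ) → ℂ := fun p =>
    (ϑ p.1 : ℂ) * (p.1 : ℂ)⁻¹ * ((|p.1| ^ (-α) : ℝ) : ℂ) with hudef
  set W : Set (ℝ × ℝ × (Fin d → ℝ)) := {p | p.1 ≠ 0} with hWdef
  have hW : IsOpen W := isOpen_ne_fun continuous_fst continuous_const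
  have hpow : ∀ c : ℝ, ContDiffOn ℝ ∞ (fun p : ℝ × ℝ × (Fin d → ℝ) => |p.1| ^ c) W := fun c p hp =>
    ((contDiffAt_fst.abs hp).rpow_const_of_ne (abs_ne_zero.2 hp)).contDiffWithinAt
  have hφW : ContDiffOn ℝ ∞ φ W := by
    refine (hpow (-β)).sub (ContDiff.contDiffOn (ContDiff.sum fun k _ => ?_))
    have := hg k
    fun_prop
  have hofReal : ContDiff ℝ ∞ ((↑) : ℝ → ℂ) := Complex.ofRealCLM.contDiff
  have huW : ContDiffOn ℝ ∞ u W := by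
    refine ContDiffOn.mul (ContDiffOn.mul ?_ (ContDiffOn.inv ?_ ?_))
      (hofReal.comp_contDiffOn (hpow (-α)))
    · exact (hofReal.comp (hϑ.comp contDiff_fst)).contDiffOn
    · exact (hofReal.comp contDiff_fst).contDiffOn
    · exact fun p hp => Complex.ofReal_ne_zero.2 hp
  have hu0 : ∀ t v, t ∉ A → u (t, v) = 0 := by
    intro t v ht
    have h : ϑ t = 0 := image_eq_zero_of_notMem_tsupport fun h => ht (hsupp h)
    simp [hudef, h]
  set U := W ∩ (fun p => fderiv ℝ φ p (1, 0)) ⁻¹' {0}ᶜ with hUdef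
  have hU : IsOpen U :=
    ((hφW.fderiv_of_isOpen hW (m := ∞) (by simp)).clm_apply
      contDiffOn_const).continuousOn.isOpen_inter_preimage hW isOpen_compl_singleton
  have hU0 : A ×ˢ (Set.Icc (0 : ℝ) 1 ×ˢ {(0 : Fin d → ℝ)}) ⊆ U := by
    rintro ⟨t, s, η⟩ ⟨ht, -, hη⟩
    obtain rfl : η = 0 := hη
    have hmem : ((t, s, 0) : ℝ × ℝ × (Fin d → ℝ)) ∈ W := hAne t ht
    refine ⟨hmem, fun h0 => deriv_abs_rpow_ne_zero hβ.ne' (hAne t ht) ?_⟩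
    have h1 : HasDerivAt (fun t => φ (t, s, 0)) (fderiv ℝ φ (t, s, 0) (1, 0)) t :=
      HasFDerivAt.comp_hasDerivAt (l := φ) t
        ((hφW.contDiffAt (hW.mem_nhds hmem)).differentiableAt (by simp)).hasFDerivAt
        ((hasDerivAt_id t).prodMk (hasDerivAt_const t _))
    have h2 : (fun t => φ (t, s, 0)) = fun t => |t| ^ (-β) := by
      funext t
      simp [hφdef]
    rw [h2] at h1
    exact h1.deriv.trans h0
  obtain ⟨ε, hε, hεU⟩ := (hA.prod (isCompact_Icc.prod isCompact_singleton)
    ).exists_cthickening_subset_open hU hU0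
  obtain ⟨C, hC⟩ := exists_norm_integral_exp_le hU hA
    (isCompact_Icc.prod (isCompact_closedBall (0 : Fin d → ℝ) ε))
    (fun ⟨t, s, η⟩ ⟨ht, hs, hη⟩ => hεU <|
      Metric.mem_cthickening_of_dist_le _ (t, s, 0) ε _ ⟨ht, hs, rfl⟩ (by
        simpa [Prod.dist_eq, hε.le] using hη))
    (hφW.mono Set.inter_subset_left) (fun p hp => hp.2) ⌈N⌉₊ (huW.mono Set.inter_subset_left) hu0
  refine ⟨ε, hε, |C| + 1, by positivity, fun j ξ hξ => ?_⟩
  set l : ℝ := (2 : ℝ) ^ ((j : ℝ) * β) with hldef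
  set s : ℝ := (2 : ℝ) ^ (-(j : ℝ)) with hsdef
  set η : Fin d → ℝ := fun k => (2 : ℝ) ^ (-(j : ℝ) * (β + a k)) * ξ k with hηdef
  have hl : 0 < l := by positivity
  have hs : s ∈ Set.Icc (0 : ℝ) 1 :=
    ⟨by positivity, Real.rpow_le_one_of_one_le_of_nonpos one_le_two (by simp)⟩
  have hη : η ∈ Metric.closedBall (0 : Fin d → ℝ) ε := by
    rw [mem_closedBall_zero_iff, pi_norm_le_iff_of_nonneg hε.le]
    intro k
    refine le_trans ?_ hξ
    exact Real.abs_le_sqrt (Finset.single_le_sum (f := fun k => η k ^ 2)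
      (fun k _ => sq_nonneg _) (Finset.mem_univ k))
  have hlη : ∀ k, l * η k = s ^ a k * ξ k := by
    intro k
    rw [hldef, hηdef, hsdef, ← mul_assoc, ← Real.rpow_add two_pos, ← Real.rpow_mul_natCast two_pos.le]
    ring_nf
  have hphase : ∀ t, l * φ (t, s, η) = l * |t| ^ (-β) - ∑ k, ξ k * γ (s * t) k := by
    intro t
    rw [hφdef, mul_sub, Finset.mul_sum]
    congr 1
    refine Finset.sum_congr rfl fun k _ => ?_
    rw [hγg, ← mul_assoc, hlη, mul_pow]
    ring
  have hbound := hC l hl (s, η) ⟨hs, hη⟩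
  simp only [hphase] at hbound
  have hlN : (l ^ ⌈N⌉₊)⁻¹ ≤ (2 : ℝ) ^ ((j : ℝ) * (-(N * β))) := by
    rw [hldef, ← Real.rpow_mul_natCast two_pos.le, ← Real.rpow_neg two_pos.le]
    refine Real.rpow_le_rpow_of_exponent_le one_le_two ?_
    have := mul_le_mul_of_nonneg_left (Nat.le_ceil N) (by positivity : 0 ≤ (j : ℝ) * β)
    linarith
  rw [multiplier, norm_smul, Real.norm_of_nonneg (by positivity)]
  calc _ ≤ (2 : ℝ) ^ ((j : ℝ) * α) * (C * (l ^ ⌈N⌉₊)⁻¹) := by gcongr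
    _ ≤ (2 : ℝ) ^ ((j : ℝ) * α) * ((|C| + 1) * (2 : ℝ) ^ ((j : ℝ) * (-(N * β)))) := by
      gcongr
      linarith [le_abs_self C]
    _ = (|C| + 1) * (2 : ℝ) ^ ((j : ℝ) * (α - N * β)) := by
      rw [mul_left_comm, ← Real.rpow_add two_pos]
      ring_nf
end

section
/- Let γ(t) = (t^{a₁}, …, t^{a_d}) with integers 1 ≤ a₁ < ⋯ < a_d, let α ∈ ℝ and β > 0, and fix a smooth cutoff ϑ supported in {t : 1/2 ≤ |t| ≤ 2}. Then there is a constant C, independent of j and ξ, such that for all j ∈ ℕ and all ξ ∈ ℝ^d, |m_j(ξ)| ≤ C · 2^{j(α − β/(d+1))}. -/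
open MeasureTheory Real Filter
open scoped Topology ENNReal

/-- The multiplier `m_j(ξ) = 2^{jα} ∫ ϑ(t) t⁻¹ |t|^{-α} e^{i(2^{jβ}|t|^{-β} - ξ·γ(2^{-j}t))} dt`
for the model monomial curve `γ(t) = (t^{a₁}, …, t^{a_d})`. -/
noncomputable def modelMultiplier (d : ℕ) (a : Fin d → ℕ) (α β : ℝ) (ϑ : ℝ → ℝ)
    (j : ℕ) (ξ : Fin d → ℝ) : ℂ :=
  ((2 : ℝ) ^ ((j : ℝ) * α) : ℝ) •
    ∫ t : ℝ, (ϑ t : ℂ) * (t : ℂ)⁻¹ * ((|t| ^ (-α) : ℝ) : ℂ) *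
      Complex.exp (Complex.I *
        (((2 : ℝ) ^ ((j : ℝ) * β) * |t| ^ (-β)
          - ∑ k, ξ k * ((2 : ℝ) ^ (-(j : ℝ)) * t) ^ (a k) : ℝ) : ℂ))

/-- If the derivative `H` of `G` satisfies `m ≤ |H|` on an interval, then
`|G| ≥ δ` off a subinterval of length at most `2δ/m`. -/
lemma exists_subinterval_forall_le_abs {G H : ℝ → ℝ} (hG : ∀ s, HasDerivAt G (H s) s)
    {u v m δ : ℝ} (huv : u ≤ v) (hm : 0 < m) (hδ : 0 < δ) (hH : ∀ s ∈ Set.Ioo u v, m ≤ |H s|) :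
    ∃ x y, u ≤ x ∧ x ≤ y ∧ y ≤ v ∧ y - x ≤ 2 * δ / m ∧
      (∀ s ∈ Set.Ioo u x, δ ≤ |G s|) ∧ ∀ s ∈ Set.Ioo y v, δ ≤ |G s| := by
  set S : Set ℝ := {s | s ∈ Set.Icc u v ∧ |G s| < δ} with hS
  have hsep : ∀ s ∈ S, ∀ t ∈ S, s ≤ t → t - s ≤ 2 * δ / m := by
    rintro s ⟨hs, hsδ⟩ t ⟨ht, htδ⟩ hst
    rcases hst.eq_or_lt with rfl | hlt
    · rw [sub_self]; positivity
    · obtain ⟨z, hz, hzeq⟩ := exists_hasDerivAt_eq_slope G H hlt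
        (fun z _ => (hG z).continuousAt.continuousWithinAt) (fun z _ => hG z)
      have hmz := hH z ⟨hs.1.trans_lt hz.1, hz.2.trans_le ht.2⟩
      have hpos : 0 < t - s := sub_pos.2 hlt
      rw [hzeq, abs_div, abs_of_pos hpos, le_div_iff₀ hpos] at hmz
      have := abs_sub (G t) (G s)
      rw [le_div_iff₀ hm]
      linarith
  rcases S.eq_empty_or_nonempty with hE | hne
  · refine ⟨v, v, huv, le_rfl, le_rfl, by rw [sub_self]; positivity, fun s hs => ?_, fun s hs => ?_⟩
    · by_contra! hlt
      exact (Set.eq_empty_iff_forall_notMem.1 hE s) ⟨⟨hs.1.le, hs.2.le⟩, hlt⟩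
    · exact absurd (hs.1.trans hs.2) (lt_irrefl _)
  · have hbb : BddBelow S := ⟨u, fun s hs => hs.1.1⟩
    have hba : BddAbove S := ⟨v, fun s hs => hs.1.2⟩
    obtain ⟨z, hz⟩ := hne
    have hinf : sInf S ≤ z := csInf_le hbb hz
    have hsup : z ≤ sSup S := le_csSup hba hz
    have hui : u ≤ sInf S := le_csInf ⟨z, hz⟩ fun s hs => hs.1.1
    have hsv : sSup S ≤ v := csSup_le ⟨z, hz⟩ fun s hs => hs.1.2
    refine ⟨sInf S, sSup S, hui, hinf.trans hsup, hsv, ?_, fun s hs => ?_, fun s hs => ?_⟩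
    · have h1 : sSup S ≤ 2 * δ / m + sInf S := by
        refine csSup_le ⟨z, hz⟩ fun t ht => ?_
        have : t - 2 * δ / m ≤ sInf S := by
          refine le_csInf ⟨z, hz⟩ fun s hs => ?_
          rcases le_total s t with h | h
          · linarith [hsep s hs t ht h]
          · have : 0 ≤ 2 * δ / m := by positivity
            linarith
        linarith
      linarith
    · by_contra! hlt
      exact absurd (csInf_le hbb (⟨⟨hs.1.le, by linarith [hs.2]⟩, hlt⟩ : s ∈ S)) (not_le.2 hs.2)
    · by_contra! hlt
      exact absurd (le_csSup hba (⟨⟨by linarith [hs.1], hs.2.le⟩, hlt⟩ : s ∈ S)) (not_le.2 hs.1)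

/-- A continuous function without zeros on an open interval has constant sign there. -/
lemma exists_sign_of_ne_zero {H : ℝ → ℝ} (hH : Continuous H) {u v : ℝ}
    (h0 : ∀ s ∈ Set.Ioo u v, H s ≠ 0) :
    ∃ σ : ℝ, |σ| = 1 ∧ ∀ s ∈ Set.Ioo u v, |H s| = σ * H s := by
  by_cases hp : ∀ s ∈ Set.Ioo u v, 0 ≤ H s
  · exact ⟨1, abs_one, fun s hs => by rw [abs_of_nonneg (hp s hs), one_mul]⟩
  · push Not at hp
    obtain ⟨x, hx, hx0⟩ := hp
    refine ⟨-1, by simp, fun s hs => ?_⟩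
    have : H s ≤ 0 := by
      by_contra! hlt
      obtain ⟨z, hz, hz0⟩ := intermediate_value_uIcc (a := x) (b := s) hH.continuousOn
        (Set.mem_uIcc.2 (Or.inl ⟨hx0.le, hlt.le⟩))
      exact h0 z (Set.ordConnected_Ioo.uIcc_subset hx hs hz) hz0
    rw [abs_of_nonpos this]; ring

/-- First derivative test for oscillatory integrals: the amplitude times
`G` equals `g` times the derivative of the phase, with `G` monotone and bounded below. -/
lemma norm_integral_mul_exp_le_of_le_abs {φ φ' G H g g' ψ : ℝ → ℝ} {u v δ B : ℝ}
    (huv : u ≤ v) (hδ : 0 < δ)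
    (hφ : ∀ s, HasDerivAt φ (φ' s) s) (hφ' : Continuous φ')
    (hG : ∀ s, HasDerivAt G (H s) s) (hHc : Continuous H)
    (hg : ∀ s, HasDerivAt g (g' s) s) (hg'c : Continuous g')
    (hrel : ∀ s, ψ s * G s = g s * φ' s)
    (hgB : ∀ s ∈ Set.Icc u v, |g s| ≤ B) (hg'B : ∀ s ∈ Set.Icc u v, |g' s| ≤ B)
    (hGδ : ∀ s ∈ Set.Ioo u v, δ ≤ |G s|) (hH0 : ∀ s ∈ Set.Ioo u v, H s ≠ 0) :
    ‖∫ s in u..v, (ψ s : ℂ) * Complex.exp (Complex.I * (φ s : ℂ))‖ ≤ B * (4 + (v - u)) / δ := by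
  have hB : 0 ≤ B := (abs_nonneg _).trans (hgB u ⟨le_rfl, huv⟩)
  rcases huv.eq_or_lt with rfl | hlt
  · rw [intervalIntegral.integral_same, norm_zero]
    have : 0 ≤ 4 + (u - u) := by norm_num
    positivity
  have hGc : Continuous G := continuous_iff_continuousAt.2 fun s => (hG s).continuousAt
  have hgc : Continuous g := continuous_iff_continuousAt.2 fun s => (hg s).continuousAt
  have hφc : Continuous φ := continuous_iff_continuousAt.2 fun s => (hφ s).continuousAt
  have hGδ' : ∀ s ∈ Set.Icc u v, δ ≤ |G s| := by
    have hcl : IsClosed {s | δ ≤ |G s|} := isClosed_le continuous_const hGc.abs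
    have := hcl.closure_subset_iff.2 (show Set.Ioo u v ⊆ _ from hGδ)
    rwa [closure_Ioo hlt.ne] at this
  have hG0 : ∀ s ∈ Set.Icc u v, G s ≠ 0 := fun s hs h => by
    have := hGδ' s hs
    rw [h, abs_zero] at this
    linarith
  have huIcc : Set.uIcc u v = Set.Icc u v := Set.uIcc_of_le huv
  obtain ⟨σ, hσ, hσH⟩ := exists_sign_of_ne_zero hHc hH0
  set Q : ℝ → ℝ := fun s => g s / G s with hQ
  set Q' : ℝ → ℝ := fun s => (g' s * G s - g s * H s) / G s ^ 2 with hQ'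
  set e : ℝ → ℂ := fun s => Complex.exp (Complex.I * (φ s : ℂ)) with he
  have hnorm : ∀ s, ‖e s‖ = 1 := fun s => by
    simpa only [he, mul_comm Complex.I] using Complex.norm_exp_ofReal_mul_I (φ s)
  have hQd : ∀ s ∈ Set.uIcc u v, HasDerivAt (fun s => (Q s : ℂ)) (Q' s : ℂ) s := fun s hs =>
    ((hg s).div (hG s) (hG0 s (huIcc ▸ hs))).ofReal_comp
  have hed : ∀ s ∈ Set.uIcc u v, HasDerivAt e (e s * (Complex.I * (φ' s : ℂ))) s := fun s _ =>
    (((hφ s).ofReal_comp).const_mul Complex.I).cexp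
  have hec : Continuous e := by fun_prop
  have hQ'c : ContinuousOn Q' (Set.uIcc u v) := by
    refine ContinuousOn.div (by fun_prop) (by fun_prop) fun s hs => ?_
    exact pow_ne_zero 2 (hG0 s (huIcc ▸ hs))
  have hQ'c2 : ContinuousOn (fun s => (Q' s : ℂ)) (Set.uIcc u v) :=
    Complex.continuous_ofReal.comp_continuousOn hQ'c
  have hibp := intervalIntegral.integral_mul_deriv_eq_deriv_mul hQd hed
    hQ'c2.intervalIntegrable
    (by fun_prop : Continuous fun s =>
      e s * (Complex.I * (φ' s : ℂ))).continuousOn.intervalIntegrable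
  have hcongr : ∫ s in u..v, (Q s : ℂ) * (e s * (Complex.I * (φ' s : ℂ))) =
      Complex.I * ∫ s in u..v, (ψ s : ℂ) * e s := by
    rw [← intervalIntegral.integral_const_mul]
    refine intervalIntegral.integral_congr fun s hs => ?_
    have h1 : Q s * φ' s = ψ s := by
      rw [hQ, div_mul_eq_mul_div, ← hrel, mul_div_cancel_right₀ _ (hG0 s (huIcc ▸ hs))]
    rw [← h1]; push_cast; ring
  have hQB : ∀ s ∈ Set.Icc u v, ‖(Q s : ℂ) * e s‖ ≤ B / δ := fun s hs => by
    rw [norm_mul, hnorm, mul_one, Complex.norm_real, Real.norm_eq_abs, hQ, abs_div]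
    exact div_le_div₀ hB (hgB s hs) hδ (hGδ' s hs)
  have hHG : ContinuousOn (fun s => H s / G s ^ 2) (Set.uIcc u v) :=
    ContinuousOn.div (by fun_prop) (by fun_prop) fun s hs => pow_ne_zero 2 (hG0 s (huIcc ▸ hs))
  have hvar : ∫ s in u..v, H s / G s ^ 2 = -(G v)⁻¹ - -(G u)⁻¹ := by
    refine intervalIntegral.integral_eq_sub_of_hasDerivAt (f := fun s => -(G s)⁻¹) (fun s hs => ?_)
      hHG.intervalIntegrable
    exact ((hG s).inv (hG0 s (huIcc ▸ hs))).neg.congr_deriv (by ring)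
  have hinv : ∀ s ∈ Set.Icc u v, |(G s)⁻¹| ≤ δ⁻¹ := fun s hs => by
    rw [abs_inv]; exact inv_anti₀ hδ (hGδ' s hs)
  have hQ'B : ‖∫ s in u..v, (Q' s : ℂ) * e s‖ ≤ B / δ * (v - u) + 2 * B / δ := by
    calc ‖∫ s in u..v, (Q' s : ℂ) * e s‖ ≤ ∫ s in u..v, ‖(Q' s : ℂ) * e s‖ :=
          intervalIntegral.norm_integral_le_integral_norm huv
      _ ≤ ∫ s in u..v, (B / δ + B * σ * (H s / G s ^ 2)) := by
          refine intervalIntegral.integral_mono_on_of_le_Ioo huv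
            (hQ'c2.mul hec.continuousOn).norm.intervalIntegrable
            (continuousOn_const.add (continuousOn_const.mul hHG)).intervalIntegrable
            fun s hs => ?_
          have hs' := Set.Ioo_subset_Icc_self hs
          have hGs := hG0 s hs'
          rw [norm_mul, hnorm, mul_one, Complex.norm_real, Real.norm_eq_abs]
          have h1 : Q' s = g' s / G s - g s * (H s / G s ^ 2) := by
            rw [hQ']; field_simp
          rw [h1]
          refine (abs_sub _ _).trans (add_le_add ?_ ?_)
          · rw [abs_div]
            exact div_le_div₀ hB (hg'B s hs') hδ (hGδ' s hs')
          · rw [abs_mul, abs_div, hσH s hs, abs_of_nonneg (sq_nonneg (G s)), mul_assoc,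
              mul_div_assoc]
            refine mul_le_mul_of_nonneg_right (hgB s hs') ?_
            rw [← mul_div_assoc, ← hσH s hs]
            positivity
      _ = B / δ * (v - u) + B * (σ * (-(G v)⁻¹ - -(G u)⁻¹)) := by
          rw [intervalIntegral.integral_add intervalIntegrable_const
            (hHG.intervalIntegrable.const_mul _), intervalIntegral.integral_const_mul,
            hvar, intervalIntegral.integral_const, smul_eq_mul]
          ring
      _ ≤ B / δ * (v - u) + 2 * B / δ := by
          have h1 : σ * (-(G v)⁻¹ - -(G u)⁻¹) ≤ 2 * δ⁻¹ := by
            refine (le_abs_self _).trans ?_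
            rw [abs_mul, hσ, one_mul]
            refine (abs_sub _ _).trans ?_
            rw [abs_neg, abs_neg]
            linarith [hinv u ⟨le_rfl, huv⟩, hinv v ⟨huv, le_rfl⟩]
          have := mul_le_mul_of_nonneg_left h1 hB
          have h2 : 2 * B / δ = B * (2 * δ⁻¹) := by ring
          linarith
  have hfin : ‖∫ s in u..v, (ψ s : ℂ) * e s‖ =
      ‖(Q v : ℂ) * e v - (Q u : ℂ) * e u - ∫ s in u..v, (Q' s : ℂ) * e s‖ := by
    rw [← hibp, hcongr, norm_mul, Complex.norm_I, one_mul]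
  rw [hfin]
  calc _ ≤ ‖(Q v : ℂ) * e v‖ + ‖(Q u : ℂ) * e u‖ + ‖∫ s in u..v, (Q' s : ℂ) * e s‖ :=
        (norm_sub_le _ _).trans (add_le_add_left (norm_sub_le _ _) _)
    _ ≤ B / δ + B / δ + (B / δ * (v - u) + 2 * B / δ) :=
        add_le_add (add_le_add (hQB v ⟨huv, le_rfl⟩) (hQB u ⟨le_rfl, huv⟩)) hQ'B
    _ = B * (4 + (v - u)) / δ := by ring

/-- A van der Corput estimate in which the successive derivatives of the phase are replaced by
`F (k + 1) = deriv (F k) - c k * F k`, where `F 0` is the derivative of the phase. -/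
lemma exists_norm_integral_mul_exp_le {ψ ψ' : ℝ → ℝ} (hψ : ∀ s, HasDerivAt ψ (ψ' s) s)
    (hψ'c : Continuous ψ') (c : ℕ → ℝ) (n : ℕ) :
    ∃ C : ℝ, 0 ≤ C ∧ ∀ (φ : ℝ → ℝ) (F : ℕ → ℝ → ℝ),
      (∀ s, HasDerivAt φ (F 0 s) s) →
      (∀ k s, HasDerivAt (F k) (F (k + 1) s + c k * F k s) s) →
      ∀ u v μ : ℝ, -1 ≤ u → u ≤ v → v ≤ 1 → 0 < μ →
      (∀ s ∈ Set.Ioo u v, μ ≤ |F n s|) → (n = 0 → ∀ s ∈ Set.Ioo u v, F 1 s ≠ 0) →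
      ‖∫ s in u..v, (ψ s : ℂ) * Complex.exp (Complex.I * (φ s : ℂ))‖
        ≤ C * μ ^ (-(1 / ((n : ℝ) + 1))) := by
  have hψc : Continuous ψ := continuous_iff_continuousAt.2 fun s => (hψ s).continuousAt
  have hw : ∀ (k : ℕ) (s : ℝ),
      HasDerivAt (fun s => Real.exp (-c k * s)) (-c k * Real.exp (-c k * s)) s := fun k s =>
    ((hasDerivAt_id' s).const_mul (-c k)).exp.congr_deriv (by ring)
  have hGd : ∀ (F : ℕ → ℝ → ℝ), (∀ k s, HasDerivAt (F k) (F (k + 1) s + c k * F k s) s) →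
      ∀ k s, HasDerivAt (fun s => Real.exp (-c k * s) * F k s)
        (Real.exp (-c k * s) * F (k + 1) s) s := fun F hF k s =>
    ((hw k s).mul (hF k s)).congr_deriv (by ring)
  have hexp : ∀ (k : ℕ) (s : ℝ), s ∈ Set.Icc (-1 : ℝ) 1 →
      Real.exp (-|c k|) ≤ Real.exp (-c k * s) ∧ Real.exp (-c k * s) ≤ Real.exp |c k| := by
    intro k s hs
    have h1 : |-c k * s| ≤ |c k| := by
      rw [abs_mul, abs_neg]
      exact mul_le_of_le_one_right (abs_nonneg _) (abs_le.2 hs)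
    exact ⟨Real.exp_le_exp.2 (abs_le.1 h1).1, Real.exp_le_exp.2 (abs_le.1 h1).2⟩
  induction n with
  | zero =>
    obtain ⟨B₁, hB₁⟩ := isCompact_Icc.exists_bound_of_continuousOn
      (f := fun s => ψ s * Real.exp (-c 0 * s)) (s := Set.Icc (-1 : ℝ) 1) (by fun_prop)
    obtain ⟨B₂, hB₂⟩ := isCompact_Icc.exists_bound_of_continuousOn
      (f := fun s => ψ' s * Real.exp (-c 0 * s) + ψ s * (-c 0 * Real.exp (-c 0 * s)))
      (s := Set.Icc (-1 : ℝ) 1) (by fun_prop)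
    have hB0 : 0 ≤ max B₁ B₂ :=
      ((norm_nonneg _).trans (hB₁ 0 (by norm_num))).trans (le_max_left _ _)
    refine ⟨max B₁ B₂ * 6 * Real.exp |c 0|, by positivity, ?_⟩
    intro φ F hφ hF u v μ hu huv hv hμ hFn h0
    have hFc : ∀ k, Continuous (F k) := fun k =>
      continuous_iff_continuousAt.2 fun s => (hF k s).continuousAt
    have hsub : Set.Icc u v ⊆ Set.Icc (-1 : ℝ) 1 := Set.Icc_subset_Icc hu hv
    have hF1 := hFc 1
    have key := norm_integral_mul_exp_le_of_le_abs (φ := φ) (φ' := F 0) (ψ := ψ)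
      (G := fun s => Real.exp (-c 0 * s) * F 0 s) (H := fun s => Real.exp (-c 0 * s) * F 1 s)
      (g := fun s => ψ s * Real.exp (-c 0 * s))
      (g' := fun s => ψ' s * Real.exp (-c 0 * s) + ψ s * (-c 0 * Real.exp (-c 0 * s)))
      (u := u) (v := v) (δ := Real.exp (-|c 0|) * μ) (B := max B₁ B₂) huv (by positivity)
      hφ (hFc 0) (hGd F hF 0) (by fun_prop) (fun s => (hψ s).mul (hw 0 s)) (by fun_prop)
      (fun s => by ring)
      (fun s hs => (hB₁ s (hsub hs)).trans (le_max_left _ _))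
      (fun s hs => (hB₂ s (hsub hs)).trans (le_max_right _ _))
      (fun s hs => by
        rw [abs_mul, abs_of_pos (Real.exp_pos _)]
        exact mul_le_mul (hexp 0 s (hsub (Set.Ioo_subset_Icc_self hs))).1 (hFn s hs) hμ.le
          (Real.exp_pos _).le)
      (fun s hs => mul_ne_zero (Real.exp_pos _).ne' (h0 rfl s hs))
    refine key.trans ?_
    have h1 : (μ : ℝ) ^ (-(1 / (((0 : ℕ) : ℝ) + 1))) = μ⁻¹ := by
      rw [Nat.cast_zero, zero_add, div_one, Real.rpow_neg_one]
    rw [h1, Real.exp_neg]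
    have h2 : max B₁ B₂ * (4 + (v - u)) / ((Real.exp |c 0|)⁻¹ * μ)
        = max B₁ B₂ * (4 + (v - u)) * Real.exp |c 0| * μ⁻¹ := by
      field_simp
    rw [h2]
    gcongr
    linarith
  | succ n ih =>
    obtain ⟨C, hC, ih⟩ := ih
    obtain ⟨A, hA⟩ := isCompact_Icc.exists_bound_of_continuousOn
      (f := ψ) (s := Set.Icc (-1 : ℝ) 1) (by fun_prop)
    have hA0 : 0 ≤ A := (norm_nonneg _).trans (hA 0 (by norm_num))
    set E := Real.exp |c n| with hE
    have hE0 : 0 < E := Real.exp_pos _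
    refine ⟨2 * (C * E⁻¹ ^ (-(1 / ((n : ℝ) + 1)))) + A * (2 * E), by positivity, ?_⟩
    intro φ F hφ hF u v μ hu huv hv hμ hFn _
    have hφc : Continuous φ := continuous_iff_continuousAt.2 fun s => (hφ s).continuousAt
    have hEn : Real.exp (-|c n|) = E⁻¹ := Real.exp_neg _
    set θ : ℝ := ((n : ℝ) + 1) / (n + 2) with hθ
    have hδ : 0 < μ ^ θ := Real.rpow_pos_of_pos hμ _
    obtain ⟨x, y, hux, hxy, hyv, hlen, hl, hr⟩ := exists_subinterval_forall_le_abs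
      (hGd F hF n) (m := E⁻¹ * μ) (δ := μ ^ θ) huv (by positivity) hδ (fun s hs => by
        rw [abs_mul, abs_of_pos (Real.exp_pos _)]
        refine mul_le_mul ?_ (hFn s hs) hμ.le (Real.exp_pos _).le
        rw [← hEn]
        exact (hexp n s ⟨hu.trans hs.1.le, hs.2.le.trans hv⟩).1)
    have hint : ∀ p q : ℝ, IntervalIntegrable
        (fun s => (ψ s : ℂ) * Complex.exp (Complex.I * (φ s : ℂ))) volume p q := fun p q =>
      (by fun_prop : Continuous fun s =>
        (ψ s : ℂ) * Complex.exp (Complex.I * (φ s : ℂ))).intervalIntegrable p q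
    have hpiece : ∀ p q : ℝ, u ≤ p → p ≤ q → q ≤ v →
        (∀ s ∈ Set.Ioo p q, μ ^ θ ≤ |Real.exp (-c n * s) * F n s|) →
        ‖∫ s in p..q, (ψ s : ℂ) * Complex.exp (Complex.I * (φ s : ℂ))‖
          ≤ C * (E⁻¹ * μ ^ θ) ^ (-(1 / ((n : ℝ) + 1))) := by
      intro p q hup hpq hqv hbd
      refine ih φ F hφ hF p q _ (hu.trans hup) hpq (hqv.trans hv) (by positivity)
        (fun s hs => ?_) (fun hn s hs h => ?_)
      · have h1 := hbd s hs
        rw [abs_mul, abs_of_pos (Real.exp_pos _)] at h1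
        have h2 := (hexp n s ⟨by linarith [hs.1], by linarith [hs.2]⟩).2
        rw [inv_mul_le_iff₀ hE0]
        exact h1.trans (mul_le_mul_of_nonneg_right h2 (abs_nonneg _))
      · have h1 := hFn s ⟨by linarith [hs.1], by linarith [hs.2]⟩
        subst hn
        rw [zero_add, h, abs_zero] at h1
        linarith
    have hmid : ‖∫ s in x..y, (ψ s : ℂ) * Complex.exp (Complex.I * (φ s : ℂ))‖
        ≤ A * (2 * μ ^ θ / (E⁻¹ * μ)) := by
      refine (intervalIntegral.norm_integral_le_of_norm_le_const (C := A) fun s hs => ?_).trans ?_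
      · rw [Set.uIoc_of_le hxy] at hs
        rw [norm_mul, mul_comm Complex.I, Complex.norm_exp_ofReal_mul_I, mul_one,
          Complex.norm_real]
        exact hA s ⟨by linarith [hs.1], by linarith [hs.2]⟩
      · rw [abs_of_nonneg (sub_nonneg.2 hxy)]
        exact mul_le_mul_of_nonneg_left hlen hA0
    have hsplit : ∫ s in u..v, (ψ s : ℂ) * Complex.exp (Complex.I * (φ s : ℂ)) =
        (∫ s in u..x, (ψ s : ℂ) * Complex.exp (Complex.I * (φ s : ℂ))) +
        (∫ s in x..y, (ψ s : ℂ) * Complex.exp (Complex.I * (φ s : ℂ))) +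
        ∫ s in y..v, (ψ s : ℂ) * Complex.exp (Complex.I * (φ s : ℂ)) := by
      rw [intervalIntegral.integral_add_adjacent_intervals (hint _ _) (hint _ _),
        intervalIntegral.integral_add_adjacent_intervals (hint _ _) (hint _ _)]
    have hn1 : (0 : ℝ) < (n : ℝ) + 1 := by positivity
    have hn2 : (0 : ℝ) < (n : ℝ) + 2 := by positivity
    have hexpo : (-(1 / (((n + 1 : ℕ) : ℝ) + 1))) = -(1 / ((n : ℝ) + 2)) := by
      push_cast; ring
    have hpow1 : (E⁻¹ * μ ^ θ) ^ (-(1 / ((n : ℝ) + 1))) =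
        E⁻¹ ^ (-(1 / ((n : ℝ) + 1))) * μ ^ (-(1 / ((n : ℝ) + 2))) := by
      rw [Real.mul_rpow (by positivity) hδ.le, ← Real.rpow_mul hμ.le]
      congr 2
      rw [hθ]; field_simp
    have hpow2 : 2 * μ ^ θ / (E⁻¹ * μ) = 2 * E * μ ^ (-(1 / ((n : ℝ) + 2))) := by
      have : (-(1 / ((n : ℝ) + 2))) = θ - 1 := by rw [hθ]; field_simp; ring
      rw [this, Real.rpow_sub_one hμ.ne']
      field_simp
    rw [hsplit, hexpo]
    refine norm_add₃_le.trans ?_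
    have h1 := hpiece u x le_rfl hux (hxy.trans hyv) hl
    have h3 := hpiece y v (hux.trans hxy) hyv le_rfl hr
    rw [hpow1] at h1 h3
    rw [hpow2] at hmid
    linarith

/-- Van der Corput estimate for phases `Λ e^{-βs} - ∑ η_k e^{a_k s}`, uniform in `η`. -/
lemma exists_norm_integral_expSum_le {d : ℕ} (a : Fin d → ℕ) {β : ℝ} (hβ : 0 < β)
    {ψ ψ' : ℝ → ℝ} (hψ : ∀ s, HasDerivAt ψ (ψ' s) s) (hψ'c : Continuous ψ') (hd : 0 < d) :
    ∃ C : ℝ, 0 ≤ C ∧ ∀ (Λ : ℝ) (η : Fin d → ℝ), 0 < Λ →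
      ‖∫ s in (-Real.log 2)..(Real.log 2), (ψ s : ℂ) * Complex.exp (Complex.I *
        ((Λ * Real.exp (-β * s) - ∑ k, η k * Real.exp (a k * s) : ℝ) : ℂ))‖
        ≤ C * Λ ^ (-(1 / ((d : ℝ) + 1))) := by
  set c : ℕ → ℝ := fun l => if h : l < d then (a ⟨l, h⟩ : ℝ) else 0 with hc
  have hc0 : ∀ l, 0 ≤ c l := fun l => by
    rw [hc]; dsimp only; split_ifs <;> positivity
  obtain ⟨C, hC, key⟩ := exists_norm_integral_mul_exp_le hψ hψ'c c d
  set P : ℝ := ∏ l ∈ Finset.range d, (β + c l) with hP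
  have hP0 : 0 < P := Finset.prod_pos fun l _ => by linarith [hc0 l]
  set κ : ℝ := β * P * Real.exp (-β) with hκ
  have hκ0 : 0 < κ := by positivity
  refine ⟨C * κ ^ (-(1 / ((d : ℝ) + 1))), by positivity, fun Λ η hΛ => ?_⟩
  have hlog0 : 0 ≤ Real.log 2 := Real.log_nonneg (by norm_num)
  have hlog1 : Real.log 2 ≤ 1 := by linarith [Real.log_two_lt_d9]
  have hE : ∀ p s : ℝ, HasDerivAt (fun s => Real.exp (p * s)) (p * Real.exp (p * s)) s :=
    fun p s => ((hasDerivAt_id' s).const_mul p).exp.congr_deriv (by ring)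
  set F : ℕ → ℝ → ℝ := fun n s =>
    Λ * (-β * ∏ l ∈ Finset.range n, (-β - c l)) * Real.exp (-β * s) -
      ∑ k, η k * (a k * ∏ l ∈ Finset.range n, ((a k : ℝ) - c l)) * Real.exp (a k * s) with hF
  have hFd : ∀ s, F d s = Λ * (-β * ∏ l ∈ Finset.range d, (-β - c l)) * Real.exp (-β * s) := by
    intro s
    rw [hF]
    dsimp only
    rw [Finset.sum_eq_zero, sub_zero]
    intro k _
    rw [Finset.prod_eq_zero (Finset.mem_range.2 k.2)]
    · ring
    · simp [hc]
  have h := key (fun s => Λ * Real.exp (-β * s) - ∑ k, η k * Real.exp (a k * s)) F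
    (fun s => ?_) (fun n s => ?_) (-Real.log 2) (Real.log 2) (κ * Λ) (by linarith) (by linarith)
    hlog1 (by positivity) (fun s hs => ?_) (fun h => absurd h hd.ne')
  · rwa [Real.mul_rpow hκ0.le hΛ.le, ← mul_assoc] at h
  · refine (((hE (-β) s).const_mul Λ).sub (HasDerivAt.fun_sum fun k _ =>
      (hE (a k) s).const_mul (η k))).congr_deriv ?_
    rw [hF]
    simp only [Finset.range_zero, Finset.prod_empty, mul_one, mul_assoc]
  · refine (((hE (-β) s).const_mul _).sub (HasDerivAt.fun_sum fun k _ =>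
      (hE (a k) s).const_mul _)).congr_deriv ?_
    rw [hF]
    simp only [Finset.prod_range_succ]
    rw [mul_sub (c n), Finset.mul_sum, sub_add_sub_comm, ← Finset.sum_add_distrib]
    congr 1
    · ring
    · exact Finset.sum_congr rfl fun k _ => by ring
  · have h1 : |∏ l ∈ Finset.range d, (-β - c l)| = P := by
      rw [Finset.abs_prod, hP]
      refine Finset.prod_congr rfl fun l _ => ?_
      rw [abs_of_nonpos (by linarith [hc0 l])]
      ring
    rw [hFd, abs_mul, abs_mul, abs_mul, h1, abs_of_pos hΛ, abs_neg, abs_of_pos hβ,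
      abs_of_pos (Real.exp_pos _), hκ]
    have h2 : Real.exp (-β) ≤ Real.exp (-β * s) := by
      refine Real.exp_le_exp.2 ?_
      nlinarith [hs.2]
    calc β * P * Real.exp (-β) * Λ ≤ β * P * Real.exp (-β * s) * Λ := by gcongr
      _ = Λ * (β * P) * Real.exp (-β * s) := by ring

/-- The integral defining the multiplier, restricted to one of the half-lines `ε t > 0`. -/
lemma exists_norm_integral_half_le {d : ℕ} (hd : 0 < d) (a : Fin d → ℕ) (α : ℝ) {β : ℝ}
    (hβ : 0 < β) {ϑ : ℝ → ℝ} (hϑ : ContDiff ℝ (⊤ : ℕ∞) ϑ) {ε : ℝ} (hε : |ε| = 1) :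
    ∃ C : ℝ, 0 ≤ C ∧ ∀ (j : ℕ) (ξ : Fin d → ℝ),
      ‖∫ t in (1 / 2 : ℝ)..2, (ϑ (ε * t) : ℂ) * ((ε * t : ℝ) : ℂ)⁻¹ *
        ((|ε * t| ^ (-α) : ℝ) : ℂ) * Complex.exp (Complex.I *
        (((2 : ℝ) ^ ((j : ℝ) * β) * |ε * t| ^ (-β)
          - ∑ k, ξ k * ((2 : ℝ) ^ (-(j : ℝ)) * (ε * t)) ^ (a k) : ℝ) : ℂ))‖
        ≤ C * ((2 : ℝ) ^ ((j : ℝ) * β)) ^ (-(1 / ((d : ℝ) + 1))) := by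
  have hϑ' : Continuous (deriv ϑ) := hϑ.continuous_deriv (by simp)
  have hε0 : ε ≠ 0 := fun h => by simp [h] at hε
  obtain ⟨C, hC, key⟩ := exists_norm_integral_expSum_le a hβ
    (ψ := fun s => ϑ (ε * Real.exp s) * Real.exp (-α * s))
    (ψ' := fun s => deriv ϑ (ε * Real.exp s) * (ε * Real.exp s) * Real.exp (-α * s) +
      ϑ (ε * Real.exp s) * (Real.exp (-α * s) * (-α * 1)))
    (fun s => (((hϑ.differentiable (by simp) _).hasDerivAt.comp s
      ((Real.hasDerivAt_exp s).const_mul ε))).mul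
        ((hasDerivAt_id' s).const_mul (-α)).exp)
    (by fun_prop) hd
  refine ⟨C, hC, fun j ξ => ?_⟩
  set f : ℝ → ℂ := fun t => (ϑ (ε * t) : ℂ) * ((ε * t : ℝ) : ℂ)⁻¹ *
        ((|ε * t| ^ (-α) : ℝ) : ℂ) * Complex.exp (Complex.I *
        (((2 : ℝ) ^ ((j : ℝ) * β) * |ε * t| ^ (-β)
          - ∑ k, ξ k * ((2 : ℝ) ^ (-(j : ℝ)) * (ε * t)) ^ (a k) : ℝ) : ℂ)) with hf
  have hϑc := hϑ.continuous
  have hfc : ContinuousOn f (Real.exp '' Set.uIcc (-Real.log 2) (Real.log 2)) := by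
    rintro _ ⟨s, _, rfl⟩
    have h0 : ε * Real.exp s ≠ 0 := mul_ne_zero hε0 (Real.exp_pos s).ne'
    refine ContinuousAt.continuousWithinAt ?_
    have hpow : ∀ p : ℝ, ContinuousAt (fun t => |ε * t| ^ p) (Real.exp s) := fun p =>
      ContinuousAt.rpow_const (by fun_prop) (Or.inl (abs_ne_zero.2 h0))
    refine ContinuousAt.mul (ContinuousAt.mul (ContinuousAt.mul (by fun_prop) ?_) ?_) ?_
    · exact ContinuousAt.inv₀ (by fun_prop) (Complex.ofReal_ne_zero.2 h0)
    · exact Complex.continuous_ofReal.continuousAt.comp (hpow _)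
    · refine ContinuousAt.cexp (continuousAt_const.mul
        (Complex.continuous_ofReal.continuousAt.comp ?_))
      exact (continuousAt_const.mul (hpow _)).sub (by fun_prop)
  have hsub := intervalIntegral.integral_deriv_smul_comp'' (f := Real.exp) (f' := Real.exp)
    (g := f) (a := -Real.log 2) (b := Real.log 2) Real.continuous_exp.continuousOn
    (fun s _ => (Real.hasDerivAt_exp s).hasDerivWithinAt) Real.continuous_exp.continuousOn hfc
  rw [Real.exp_neg, Real.exp_log two_pos, ← one_div] at hsub
  rw [← hsub]
  have h := key ((2 : ℝ) ^ ((j : ℝ) * β)) (fun k => ξ k * ((2 : ℝ) ^ (-(j : ℝ)) * ε) ^ (a k))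
    (by positivity)
  have hεε : (ε : ℂ) ≠ 0 := Complex.ofReal_ne_zero.2 hε0
  have hpt : ∀ s : ℝ, Real.exp s • (f ∘ Real.exp) s = (ε : ℂ)⁻¹ *
      (((ϑ (ε * Real.exp s) * Real.exp (-α * s) : ℝ) : ℂ) * Complex.exp (Complex.I *
        (((2 : ℝ) ^ ((j : ℝ) * β) * Real.exp (-β * s) - ∑ k, ξ k *
          ((2 : ℝ) ^ (-(j : ℝ)) * ε) ^ (a k) * Real.exp (a k * s) : ℝ) : ℂ))) := by
    intro s
    have habs : ∀ p : ℝ, |ε * Real.exp s| ^ (-p) = Real.exp (-p * s) := fun p => by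
      rw [abs_mul, hε, one_mul, abs_of_pos (Real.exp_pos s), ← Real.exp_mul, mul_comm]
    have hsum : ∑ k, ξ k * ((2 : ℝ) ^ (-(j : ℝ)) * (ε * Real.exp s)) ^ (a k) =
        ∑ k, ξ k * ((2 : ℝ) ^ (-(j : ℝ)) * ε) ^ (a k) * Real.exp (a k * s) :=
      Finset.sum_congr rfl fun k _ => by
        rw [← mul_assoc, mul_pow _ (Real.exp s), ← Real.exp_nat_mul, mul_assoc]
    have hes : (Real.exp s : ℂ) ≠ 0 := Complex.ofReal_ne_zero.2 (Real.exp_pos s).ne'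
    simp only [hf, Function.comp_apply, habs, hsum, Complex.real_smul, Complex.ofReal_mul ε,
      Complex.ofReal_mul (ϑ _)]
    field_simp
  rw [intervalIntegral.integral_congr fun s _ => hpt s, intervalIntegral.integral_const_mul,
    norm_mul, norm_inv, Complex.norm_real, Real.norm_eq_abs, hε, inv_one, one_mul]
  exact h

/-- Dyadic multiplier estimate for the model monomial curve `γ(t) = (t^{a₁}, …, t^{a_d})`:
`|m_j(ξ)| ≤ C 2^{j(α - β/(d+1))}` uniformly in `j` and `ξ`. -/
theorem model_dyadic_multiplier_estimate
    (d : ℕ) (hd : 0 < d) (a : Fin d → ℕ) (ha : StrictMono a) (ha1 : ∀ k, 1 ≤ a k)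
    (α β : ℝ) (hβ : 0 < β)
    (ϑ : ℝ → ℝ) (hϑ : ContDiff ℝ (⊤ : ℕ∞) ϑ)
    (hsupp : tsupport ϑ ⊆ {t : ℝ | 1 / 2 ≤ |t| ∧ |t| ≤ 2}) :
    ∃ C : ℝ, 0 < C ∧ ∀ (j : ℕ) (ξ : Fin d → ℝ),
      ‖modelMultiplier d a α β ϑ j ξ‖ ≤ C * (2 : ℝ) ^ ((j : ℝ) * (α - β / (d + 1))) := by
  obtain ⟨C₁, hC₁, h₁⟩ := exists_norm_integral_half_le hd a α hβ hϑ (ε := 1) abs_one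
  obtain ⟨C₂, hC₂, h₂⟩ := exists_norm_integral_half_le hd a α hβ hϑ (ε := -1) (by simp)
  refine ⟨C₁ + C₂ + 1, by positivity, fun j ξ => ?_⟩
  have h₁ := h₁ j ξ
  have h₂ := h₂ j ξ
  unfold modelMultiplier
  set f : ℝ → ℂ := fun t => (ϑ t : ℂ) * (t : ℂ)⁻¹ * ((|t| ^ (-α) : ℝ) : ℂ) *
      Complex.exp (Complex.I *
        (((2 : ℝ) ^ ((j : ℝ) * β) * |t| ^ (-β)
          - ∑ k, ξ k * ((2 : ℝ) ^ (-(j : ℝ)) * t) ^ (a k) : ℝ) : ℂ)) with hf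
  have hϑc := hϑ.continuous
  have hfc : ∀ t : ℝ, t ≠ 0 → ContinuousAt f t := by
    intro t ht
    have hpow : ∀ p : ℝ, ContinuousAt (fun t : ℝ => |t| ^ p) t := fun p =>
      ContinuousAt.rpow_const (by fun_prop) (Or.inl (abs_ne_zero.2 ht))
    refine ContinuousAt.mul (ContinuousAt.mul (ContinuousAt.mul (by fun_prop) ?_) ?_) ?_
    · exact ContinuousAt.inv₀ (by fun_prop) (Complex.ofReal_ne_zero.2 ht)
    · exact Complex.continuous_ofReal.continuousAt.comp (hpow _)
    · refine ContinuousAt.cexp (continuousAt_const.mul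
        (Complex.continuous_ofReal.continuousAt.comp ?_))
      exact (continuousAt_const.mul (hpow _)).sub (by fun_prop)
  have hpos : ContinuousOn f (Set.Icc (1 / 2) 2) := fun t ht =>
    (hfc t (by linarith [ht.1] : (0 : ℝ) < t).ne').continuousWithinAt
  have hneg : ContinuousOn f (Set.Icc (-2) (-(1 / 2))) := fun t ht =>
    (hfc t (by linarith [ht.2] : t < (0 : ℝ)).ne).continuousWithinAt
  have hzero : ∀ t, t ∉ Set.Icc (1 / 2 : ℝ) 2 ∪ Set.Icc (-2) (-(1 / 2)) → f t = 0 := by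
    intro t ht
    have h0 : ϑ t = 0 := by
      by_contra hne
      obtain ⟨h1, h2⟩ := hsupp (subset_tsupport ϑ hne)
      refine ht ?_
      rcases abs_cases t with ⟨h, _⟩ | ⟨h, _⟩ <;> rw [h] at h1 h2
      · exact Or.inl ⟨h1, h2⟩
      · exact Or.inr ⟨by linarith, by linarith⟩
    simp [hf, h0]
  have hdisj : Disjoint (Set.Icc (1 / 2 : ℝ) 2) (Set.Icc (-2) (-(1 / 2))) :=
    Set.disjoint_left.2 fun t h1 h2 => by linarith [h1.1, h2.2]
  have hint : ∫ t, f t =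
      (∫ t in (1 / 2 : ℝ)..2, f (1 * t)) + ∫ t in (1 / 2 : ℝ)..2, f (-1 * t) := by
    rw [← setIntegral_eq_integral_of_forall_compl_eq_zero hzero,
      setIntegral_union hdisj measurableSet_Icc hpos.integrableOn_Icc hneg.integrableOn_Icc,
      integral_Icc_eq_integral_Ioc, integral_Icc_eq_integral_Ioc,
      ← intervalIntegral.integral_of_le (by norm_num),
      ← intervalIntegral.integral_of_le (by norm_num)]
    simp only [one_mul, neg_one_mul, intervalIntegral.integral_comp_neg]
  have hbound : ‖∫ t, f t‖ ≤ (C₁ + C₂) * ((2 : ℝ) ^ ((j : ℝ) * β)) ^ (-(1 / ((d : ℝ) + 1))) := by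
    rw [hint, add_mul]
    exact (norm_add_le _ _).trans (add_le_add h₁ h₂)
  have hexp : (2 : ℝ) ^ ((j : ℝ) * (α - β / (d + 1))) =
      (2 : ℝ) ^ ((j : ℝ) * α) * ((2 : ℝ) ^ ((j : ℝ) * β)) ^ (-(1 / ((d : ℝ) + 1))) := by
    rw [← Real.rpow_mul two_pos.le, ← Real.rpow_add two_pos]
    ring_nf
  rw [norm_smul, Real.norm_eq_abs, abs_of_pos (by positivity), hexp, mul_left_comm]
  refine mul_le_mul_of_nonneg_left (hbound.trans ?_) (by positivity)
  exact mul_le_mul_of_nonneg_right (by linarith) (by positivity)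
end
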